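/- Let θ ∈ (arccos(2/π), π/3) (equivalently 1/2 < cos θ < 2/π), and let β₁ ∈ (1, ∞) be a real number satisfying arccos(1/β₁) = (β₁ + cos θ)·√(β₁² − 1) / (β₁·(β₁ cos θ + 1)). Then the hypercube-LSH collision probability satisfies lim_{d→∞} (1/d)·ln p_d(θ) = ln( (β₁ + cos θ)² / (π · β₁ · (β₁ cos θ + 1) · sin θ) ). -/

import Mathlib

open MeasureTheory Real Filter

noncomputable section

instance (d : ℕ) : MeasurableSpace (Matrix (Fin d) (Fin d) ℝ) := MeasurableSpace.pi

/-- The sign function: `+1` if `t ≥ 0` and `-1` if `t < 0`. -/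
def sgn (t : ℝ) : ℝ := if 0 ≤ t then 1 else -1

/-- The unit vector `x = e₁` in `ℝ^d`. -/
def xvec (d : ℕ) : Fin d → ℝ := fun i => if (i : ℕ) = 0 then 1 else 0

/-- The unit vector `y = (cos θ) e₁ + (sin θ) e₂` in `ℝ^d`. -/
def yvec (d : ℕ) (θ : ℝ) : Fin d → ℝ :=
  fun i => if (i : ℕ) = 0 then Real.cos θ else if (i : ℕ) = 1 then Real.sin θ else 0

/-- The event that the hypercube hashes of `x` and `y` coincide:
`h_A(x) = h_A(y)` where `h_A(v) = (sgn((Av)₁), …, sgn((Av)_d))`. -/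
def collisionEvent (d : ℕ) (θ : ℝ) : Set (Matrix.orthogonalGroup (Fin d) ℝ) :=
  {A | ∀ i : Fin d,
    sgn (((A : Matrix (Fin d) (Fin d) ℝ).mulVec (xvec d)) i)
      = sgn (((A : Matrix (Fin d) (Fin d) ℝ).mulVec (yvec d θ)) i)}

/-- The hypercube-LSH collision probability `p_d(θ)`, where `μ` is the Haar probability
measure on the orthogonal group `O(d)`. -/
def collProb (d : ℕ) (θ : ℝ) (μ : Measure (Matrix.orthogonalGroup (Fin d) ℝ)) : ℝ :=
  (μ (collisionEvent d θ)).toReal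

instance borelMat (d : ℕ) : BorelSpace (Matrix (Fin d) (Fin d) ℝ) :=
  Pi.borelSpace (X := fun _ : Fin d => Fin d → ℝ)

lemma isClosed_orth (d : ℕ) :
    IsClosed ((Matrix.orthogonalGroup (Fin d) ℝ : Set (Matrix (Fin d) (Fin d) ℝ))) := by
  have : ((Matrix.orthogonalGroup (Fin d) ℝ : Set (Matrix (Fin d) (Fin d) ℝ)))
      = {A | A * star A = 1} := by
    ext A
    exact Matrix.mem_orthogonalGroup_iff (Fin d) ℝ
  rw [this]
  exact isClosed_eq (by fun_prop) continuous_const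

instance lcOrth (d : ℕ) : LocallyCompactSpace (Matrix.orthogonalGroup (Fin d) ℝ) := by
  have : LocallyCompactSpace (Matrix (Fin d) (Fin d) ℝ) :=
    inferInstanceAs (LocallyCompactSpace (Fin d → Fin d → ℝ))
  exact (isClosed_orth d).isClosedEmbedding_subtypeVal.locallyCompactSpace

lemma right_inv (d : ℕ) (μ : Measure (Matrix.orthogonalGroup (Fin d) ℝ)) [μ.IsHaarMeasure]
    [IsProbabilityMeasure μ] (B : Matrix.orthogonalGroup (Fin d) ℝ) :
    μ.map (· * B) = μ := by
  have : IsProbabilityMeasure (μ.map (· * B)) :=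
    Measure.isProbabilityMeasure_map (by fun_prop)
  have : (μ.map (· * B)).IsHaarMeasure := by infer_instance
  exact Measure.isHaarMeasure_eq_of_isProbabilityMeasure _ _

/-- action on pairs -/
def act {d : ℕ} (A : Matrix (Fin d) (Fin d) ℝ) (w : Fin d → ℝ × ℝ) : Fin d → ℝ × ℝ :=
  fun i => (A.mulVec (fun j => (w j).1) i, A.mulVec (fun j => (w j).2) i)

lemma act_mp {d : ℕ} (A : Matrix (Fin d) (Fin d) ℝ) (hA : A ∈ Matrix.orthogonalGroup (Fin d) ℝ) :
    MeasurePreserving (act A) volume volume := by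
  have h1 : MeasurePreserving (Matrix.toLin' A) volume volume := by
    refine ⟨(Matrix.toLin' A).continuous_of_finiteDimensional.measurable, ?_⟩
    have hdet : |A.det| = 1 := by
      have := (Matrix.mem_orthogonalGroup_iff (Fin d) ℝ).1 hA
      have h2 := congrArg Matrix.det this
      rw [Matrix.det_mul, Matrix.det_transpose, Matrix.det_one] at h2
      rcases mul_self_eq_one_iff.1 h2 with h | h <;> simp [h]
    have hne : A.det ≠ 0 := by intro h; simp [h] at hdet
    rw [Real.map_matrix_volume_pi_eq_smul_volume_pi hne, abs_inv, hdet]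
    simp
  have h2 := volume_measurePreserving_arrowProdEquivProdArrow ℝ ℝ (Fin d)
  have h3 := (h2.symm).comp ((h1.prod h1).comp h2)
  exact h3

def Qset (d : ℕ) : Set (Fin d → ℝ × ℝ) := {w | ∀ i, sgn (w i).1 = sgn (w i).2}

def N1 {d : ℕ} (w : Fin d → ℝ × ℝ) : ℝ := ∑ i, (w i).1 ^ 2
def N2 {d : ℕ} (w : Fin d → ℝ × ℝ) : ℝ := ∑ i, (w i).2 ^ 2
def NC {d : ℕ} (w : Fin d → ℝ × ℝ) : ℝ := ∑ i, (w i).1 * (w i).2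

lemma dot_inv {d : ℕ} (A : Matrix (Fin d) (Fin d) ℝ) (hA : A ∈ Matrix.orthogonalGroup (Fin d) ℝ)
    (u v : Fin d → ℝ) : ∑ i, A.mulVec u i * A.mulVec v i = ∑ i, u i * v i := by
  have h := (Matrix.mem_orthogonalGroup_iff' (Fin d) ℝ).1 hA
  change A.mulVec u ⬝ᵥ A.mulVec v = u ⬝ᵥ v
  rw [Matrix.dotProduct_mulVec, Matrix.vecMul_mulVec]
  rw [h, Matrix.vecMul_one]

lemma N1_act {d : ℕ} (A : Matrix (Fin d) (Fin d) ℝ) (hA : A ∈ Matrix.orthogonalGroup (Fin d) ℝ)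
    (w : Fin d → ℝ × ℝ) : N1 (act A w) = N1 w := by
  simp only [N1, act, sq]; exact dot_inv A hA _ _
lemma N2_act {d : ℕ} (A : Matrix (Fin d) (Fin d) ℝ) (hA : A ∈ Matrix.orthogonalGroup (Fin d) ℝ)
    (w : Fin d → ℝ × ℝ) : N2 (act A w) = N2 w := by
  simp only [N2, act, sq]; exact dot_inv A hA _ _
lemma NC_act {d : ℕ} (A : Matrix (Fin d) (Fin d) ℝ) (hA : A ∈ Matrix.orthogonalGroup (Fin d) ℝ)
    (w : Fin d → ℝ × ℝ) : NC (act A w) = NC w := by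
  simp only [NC, act]; exact dot_inv A hA _ _

lemma sgn_pos_mul {a : ℝ} (ha : 0 < a) (t : ℝ) : sgn (a * t) = sgn t := by
  unfold sgn
  simp [mul_nonneg_iff_of_pos_left ha]

lemma sgn_comb {a b x y : ℝ} (ha : 0 ≤ a) (hb : 0 < b) (h : sgn x = sgn y) :
    sgn x = sgn (a * x + b * y) := by
  unfold sgn at *
  by_cases hx : 0 ≤ x <;> by_cases hy : 0 ≤ y
  · rw [if_pos hx, if_pos (by positivity)]
  · rw [if_pos hx, if_neg hy] at h; norm_num at h
  · rw [if_neg hx, if_pos hy] at h; norm_num at h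
  · rw [if_neg hx, if_neg]
    push Not at hx hy ⊢
    have := mul_nonpos_of_nonneg_of_nonpos ha hx.le
    have := mul_neg_of_pos_of_neg hb hy
    linarith

lemma coll_iff (n : ℕ) (θ : ℝ) (A : Matrix.orthogonalGroup (Fin (n+2)) ℝ) :
    A ∈ collisionEvent (n+2) θ ↔
      ∀ i, sgn (A.1 i 0) = sgn (cos θ * A.1 i 0 + sin θ * A.1 i 1) := by
  have hx : ∀ i, (A.1).mulVec (xvec (n+2)) i = A.1 i 0 := by
    intro i
    simp only [Matrix.mulVec, dotProduct, Fin.sum_univ_succ, xvec]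
    simp
  have hy : ∀ i, (A.1).mulVec (yvec (n+2) θ) i = cos θ * A.1 i 0 + sin θ * A.1 i 1 := by
    intro i
    simp only [Matrix.mulVec, dotProduct, Fin.sum_univ_succ, yvec]
    simp
    ring
  simp only [collisionEvent, Set.mem_ofPred_eq, hx, hy]

/-- structure of a pair -/
lemma exists_frame (n : ℕ) (w : Fin (n+2) → ℝ × ℝ) (h1 : 0 < N1 w)
    (h2 : NC w ^ 2 < N1 w * N2 w) :
    ∃ B : Matrix.orthogonalGroup (Fin (n+2)) ℝ, ∃ a c s : ℝ, 0 < a ∧ 0 < s ∧ a ^ 2 = N1 w ∧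
      c * a = NC w ∧ c ^ 2 + s ^ 2 = N2 w ∧ (∀ j, (w j).1 = a * B.1 j 0) ∧
      (∀ j, (w j).2 = c * B.1 j 0 + s * B.1 j 1) := by
  set a := √(N1 w) with ha
  have ha0 : 0 < a := Real.sqrt_pos.2 h1
  have ha2 : a ^ 2 = N1 w := Real.sq_sqrt h1.le
  set c := NC w / a with hc
  have hca : c * a = NC w := by rw [hc]; field_simp
  have hpos : 0 < N2 w - c ^ 2 := by
    rw [← hca, ← ha2, mul_pow, mul_comm] at h2
    have := lt_of_mul_lt_mul_left h2 (by positivity)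
    linarith
  set s := √(N2 w - c ^ 2) with hs
  have hs0 : 0 < s := Real.sqrt_pos.2 hpos
  have hs2 : s ^ 2 = N2 w - c ^ 2 := Real.sq_sqrt hpos.le
  let u : EuclideanSpace ℝ (Fin (n+2)) := WithLp.toLp 2 (fun j => (w j).1 / a)
  let v : EuclideanSpace ℝ (Fin (n+2)) := WithLp.toLp 2 (fun j => ((w j).2 - c * ((w j).1 / a)) / s)
  have huu : inner ℝ u u = (1 : ℝ) := by
    simp only [PiLp.inner_apply, u]
    simp only [RCLike.inner_apply, conj_trivial]
    have : ∀ i, (w i).1 / a * ((w i).1 / a) = (w i).1 ^ 2 / a ^ 2 := by intro i; ring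
    simp only [this]
    rw [← Finset.sum_div, ha2]
    exact div_self h1.ne'
  have huv : inner ℝ u v = (0 : ℝ) := by
    simp only [PiLp.inner_apply, u, v]
    simp only [RCLike.inner_apply, conj_trivial]
    have : ∀ i, ((w i).2 - c * ((w i).1 / a)) / s * ((w i).1 / a)
      = (1 / (s * a)) * ((w i).1 * (w i).2) - c / (s * a ^ 2) * (w i).1 ^ 2 := by
      intro i; field_simp
    simp only [this]
    rw [Finset.sum_sub_distrib, ← Finset.mul_sum, ← Finset.mul_sum]
    change 1 / (s * a) * NC w - c / (s * a ^ 2) * N1 w = 0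
    rw [← hca, ← ha2]; field_simp; ring
  have hvv : inner ℝ v v = (1 : ℝ) := by
    simp only [PiLp.inner_apply, v]
    simp only [RCLike.inner_apply, conj_trivial]
    have : ∀ i, ((w i).2 - c * ((w i).1 / a)) / s * (((w i).2 - c * ((w i).1 / a)) / s)
      = (1 / s ^ 2) * (w i).2 ^ 2 - (2 * c / (a * s ^ 2)) * ((w i).1 * (w i).2)
        + c ^ 2 / (s ^ 2 * a ^ 2) * (w i).1 ^ 2 := by
      intro i; field_simp; ring
    simp only [this]
    rw [Finset.sum_add_distrib, Finset.sum_sub_distrib, ← Finset.mul_sum, ← Finset.mul_sum,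
      ← Finset.mul_sum]
    change 1 / s ^ 2 * N2 w - 2 * c / (a * s ^ 2) * NC w + c ^ 2 / (s ^ 2 * a ^ 2) * N1 w = 1
    have : N2 w = s ^ 2 + c ^ 2 := by linarith
    rw [← hca, ← ha2, this]; field_simp; ring
  let f : Fin (n+2) → EuclideanSpace ℝ (Fin (n+2)) := fun j => if j = 0 then u else v
  obtain ⟨b, hb⟩ := Orthonormal.exists_orthonormalBasis_extension_of_card_eq (𝕜 := ℝ)
    (E := EuclideanSpace ℝ (Fin (n+2))) (ι := Fin (n+2)) (by simp) (v := f) (s := {0, 1}) (by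
      rw [orthonormal_iff_ite]
      rintro ⟨i, hi⟩ ⟨j, hj⟩
      rcases hi with rfl | rfl <;> rcases hj with rfl | rfl <;>
        simp [f, huu, huv, hvv, real_inner_comm u v ▸ huv, -inner_self_eq_norm_sq_to_K, Subtype.ext_iff])
  have hb0 : b 0 = u := by rw [hb 0 (by simp)]; simp [f]
  have hb1 : b 1 = v := by rw [hb 1 (by simp)]; simp [f]
  let B : Matrix (Fin (n+2)) (Fin (n+2)) ℝ := Matrix.of fun i j => b j i
  have hB : B ∈ Matrix.orthogonalGroup (Fin (n+2)) ℝ := by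
    rw [Matrix.mem_orthogonalGroup_iff']
    ext i j
    have := orthonormal_iff_ite.1 b.orthonormal i j
    rw [Matrix.mul_apply, Matrix.one_apply, ← this]
    simp only [PiLp.inner_apply, RCLike.inner_apply, conj_trivial]
    refine Finset.sum_congr rfl fun k _ => ?_
    simp [B, mul_comm]
  refine ⟨⟨B, hB⟩, a, c, s, ha0, hs0, ha2, hca, by linarith, ?_, ?_⟩
  · intro j
    change (w j).1 = a * b 0 j
    rw [hb0]; simp only [u]; field_simp
  · intro j
    change (w j).2 = c * b 0 j + s * b 1 j
    rw [hb0, hb1]; simp only [u, v]; field_simp; ring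

lemma meas_entry (d : ℕ) (i j : Fin d) :
    Measurable (fun A : Matrix.orthogonalGroup (Fin d) ℝ => A.1 i j) := by
  have h : Measurable (fun A : Matrix (Fin d) (Fin d) ℝ => A i j) :=
    (measurable_pi_apply j).comp (measurable_pi_apply (X := fun _ : Fin d => Fin d → ℝ) i)
  exact h.comp measurable_subtype_coe

lemma meas_sgn : Measurable sgn :=
  Measurable.ite measurableSet_Ici measurable_const measurable_const

lemma meas_Q (d : ℕ) : MeasurableSet (Qset d) := by
  have : Qset d = ⋂ i, {w | sgn (w i).1 = sgn (w i).2} := by ext; simp [Qset]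
  rw [this]
  refine MeasurableSet.iInter fun i => measurableSet_eq_fun ?_ ?_
  · exact meas_sgn.comp (by fun_prop)
  · exact meas_sgn.comp (by fun_prop)

lemma meas_actQ (d : ℕ) : MeasurableSet
    {p : Matrix.orthogonalGroup (Fin d) ℝ × (Fin d → ℝ × ℝ) | act p.1.1 p.2 ∈ Qset d} := by
  have : Measurable (fun p : Matrix.orthogonalGroup (Fin d) ℝ × (Fin d → ℝ × ℝ) =>
      act p.1.1 p.2) := by
    refine measurable_pi_lambda _ fun i => ?_
    refine Measurable.prodMk ?_ ?_
    · simp only [Matrix.mulVec, dotProduct]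
      refine Finset.measurable_sum _ fun j _ => ?_
      exact ((meas_entry d i j).comp measurable_fst).mul (by fun_prop)
    · simp only [Matrix.mulVec, dotProduct]
      refine Finset.measurable_sum _ fun j _ => ?_
      exact ((meas_entry d i j).comp measurable_fst).mul (by fun_prop)
  exact this (meas_Q d)

lemma meas_coll (n : ℕ) (θ : ℝ) : MeasurableSet (collisionEvent (n+2) θ) := by
  have : collisionEvent (n+2) θ = ⋂ i, {A | sgn (A.1 i 0) = sgn (cos θ * A.1 i 0 + sin θ * A.1 i 1)} := by
    ext A; rw [coll_iff]; simp
  rw [this]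
  refine MeasurableSet.iInter fun i => measurableSet_eq_fun ?_ ?_
  · exact meas_sgn.comp (meas_entry _ _ _)
  · exact meas_sgn.comp (((meas_entry _ _ _).const_mul _).add ((meas_entry _ _ _).const_mul _))

lemma actQ_iff (n : ℕ) (w : Fin (n+2) → ℝ × ℝ) (B A : Matrix.orthogonalGroup (Fin (n+2)) ℝ)
    (a c s : ℝ) (ha : 0 < a) (h1 : ∀ j, (w j).1 = a * B.1 j 0)
    (h2 : ∀ j, (w j).2 = c * B.1 j 0 + s * B.1 j 1) :
    act A.1 w ∈ Qset (n+2) ↔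
      ∀ i, sgn ((A * B).1 i 0) = sgn (c * (A * B).1 i 0 + s * (A * B).1 i 1) := by
  have e1 : ∀ i, (act A.1 w i).1 = a * (A * B).1 i 0 := by
    intro i
    simp only [act, h1, Matrix.mulVec, dotProduct, Submonoid.coe_mul, Matrix.mul_apply, Finset.mul_sum]
    exact Finset.sum_congr rfl fun _ _ => by ring
  have e2 : ∀ i, (act A.1 w i).2 = c * (A * B).1 i 0 + s * (A * B).1 i 1 := by
    intro i
    simp only [act, h2, Matrix.mulVec, dotProduct, Submonoid.coe_mul, Matrix.mul_apply, Finset.mul_sum]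
    rw [← Finset.sum_add_distrib]
    exact Finset.sum_congr rfl fun _ _ => by ring
  simp only [Qset, Set.mem_ofPred_eq, e1, e2, sgn_pos_mul ha]

lemma pre_right (n : ℕ) (μ : Measure (Matrix.orthogonalGroup (Fin (n+2)) ℝ)) [μ.IsHaarMeasure]
    [IsProbabilityMeasure μ] (θ : ℝ) (B : Matrix.orthogonalGroup (Fin (n+2)) ℝ) :
    μ {A | A * B ∈ collisionEvent (n+2) θ} = μ (collisionEvent (n+2) θ) := by
  conv_rhs => rw [← right_inv _ μ B, Measure.map_apply (by fun_prop) (meas_coll n θ)]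
  rfl

lemma coll_le (n : ℕ) (μ : Measure (Matrix.orthogonalGroup (Fin (n+2)) ℝ)) [μ.IsHaarMeasure]
    [IsProbabilityMeasure μ] (θ : ℝ) (hs : 0 < sin θ) (hc : 0 < cos θ)
    (w : Fin (n+2) → ℝ × ℝ) (h1 : 0 < N1 w)
    (h2 : NC w ^ 2 < N1 w * N2 w) (h0 : 0 ≤ NC w)
    (h3 : cos θ ^ 2 * (N1 w * N2 w) ≤ NC w ^ 2) :
    μ (collisionEvent (n+2) θ) ≤ μ {A | act A.1 w ∈ Qset (n+2)} := by
  obtain ⟨B, a, c, s, ha, hs0, ha2, hca, hcs, e1, e2⟩ := exists_frame n w h1 h2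
  rw [← pre_right n μ θ B]
  refine measure_mono fun A hA => ?_
  rw [Set.mem_ofPred_eq, coll_iff] at hA
  rw [Set.mem_ofPred_eq, actQ_iff n w B A a c s ha e1 e2]
  intro i
  have hc0 : 0 ≤ c := nonneg_of_mul_nonneg_left (by rw [hca]; exact h0) ha
  have key : cos θ * s ≤ c * sin θ := by
    rw [← ha2, ← hcs, ← hca] at h3
    have h4 : cos θ ^ 2 * (c ^ 2 + s ^ 2) ≤ c ^ 2 := by
      have : a ^ 2 * (cos θ ^ 2 * (c ^ 2 + s ^ 2)) ≤ a ^ 2 * c ^ 2 := by nlinarith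
      exact le_of_mul_le_mul_left this (by positivity)
    have := sin_sq_add_cos_sq θ
    refine (sq_le_sq₀ (by positivity) (by positivity)).1 ?_
    nlinarith
  have := sgn_comb (a := c - s / sin θ * cos θ) (b := s / sin θ) (by
    rw [sub_nonneg, div_mul_eq_mul_div, div_le_iff₀ hs]; linarith) (by positivity) (hA i)
  rw [this]
  congr 1
  field_simp
  ring

lemma le_coll (n : ℕ) (μ : Measure (Matrix.orthogonalGroup (Fin (n+2)) ℝ)) [μ.IsHaarMeasure]
    [IsProbabilityMeasure μ] (θ : ℝ) (hs : 0 < sin θ) (hc : 0 < cos θ)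
    (w : Fin (n+2) → ℝ × ℝ) (h1 : 0 < N1 w)
    (h2 : NC w ^ 2 < N1 w * N2 w) (h0 : 0 ≤ NC w)
    (h3 : NC w ^ 2 ≤ cos θ ^ 2 * (N1 w * N2 w)) :
    μ {A | act A.1 w ∈ Qset (n+2)} ≤ μ (collisionEvent (n+2) θ) := by
  obtain ⟨B, a, c, s, ha, hs0, ha2, hca, hcs, e1, e2⟩ := exists_frame n w h1 h2
  rw [← pre_right n μ θ B]
  refine measure_mono fun A hA => ?_
  rw [Set.mem_ofPred_eq, actQ_iff n w B A a c s ha e1 e2] at hA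
  rw [Set.mem_ofPred_eq, coll_iff]
  intro i
  have hc0 : 0 ≤ c := nonneg_of_mul_nonneg_left (by rw [hca]; exact h0) ha
  have key : c * sin θ ≤ cos θ * s := by
    rw [← ha2, ← hcs, ← hca] at h3
    have h4 : c ^ 2 ≤ cos θ ^ 2 * (c ^ 2 + s ^ 2) := by
      have : a ^ 2 * c ^ 2 ≤ a ^ 2 * (cos θ ^ 2 * (c ^ 2 + s ^ 2)) := by nlinarith
      exact le_of_mul_le_mul_left this (by positivity)
    have := sin_sq_add_cos_sq θ
    refine (sq_le_sq₀ (by positivity) (by positivity)).1 ?_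
    nlinarith
  have := sgn_comb (a := cos θ - sin θ / s * c) (b := sin θ / s) (by
    rw [sub_nonneg, div_mul_eq_mul_div, div_le_iff₀ hs0]; linarith) (by positivity) (hA i)
  rw [this]
  congr 1
  field_simp
  ring

lemma fubini_id (n : ℕ) (μ : Measure (Matrix.orthogonalGroup (Fin (n+2)) ℝ))
    [IsProbabilityMeasure μ] (E : Set (Fin (n+2) → ℝ × ℝ)) (hE : MeasurableSet E)
    (hinv : ∀ A ∈ Matrix.orthogonalGroup (Fin (n+2)) ℝ, ∀ w, act A w ∈ E ↔ w ∈ E) :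
    volume (E ∩ Qset (n+2)) = ∫⁻ w in E, μ {A | act A.1 w ∈ Qset (n+2)} := by
  have hM := (meas_actQ (n+2)).inter (measurable_snd hE)
  have e1 := Measure.prod_apply (μ := μ) (ν := volume) hM
  have e2 := Measure.prod_apply_symm (μ := μ) (ν := volume) hM
  rw [e1] at e2
  have l : ∀ A : Matrix.orthogonalGroup (Fin (n+2)) ℝ,
      volume (Prod.mk A ⁻¹' ({p : Matrix.orthogonalGroup (Fin (n+2)) ℝ × (Fin (n+2) → ℝ × ℝ) |
        act p.1.1 p.2 ∈ Qset (n+2)} ∩ Prod.snd ⁻¹' E)) = volume (E ∩ Qset (n+2)) := by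
    intro A
    rw [← (act_mp A.1 A.2).measure_preimage (hE.inter (meas_Q _)).nullMeasurableSet]
    congr 1
    ext w
    simp [hinv A.1 A.2 w, and_comm]
  simp only [l, lintegral_const, measure_univ, mul_one] at e2
  rw [e2, ← lintegral_indicator hE]
  refine lintegral_congr fun w => ?_
  by_cases hw : w ∈ E
  · simp [hw, Set.preimage]
  · simp [hw, Set.preimage]

def Eset (d : ℕ) (ρ δ : ℝ) : Set (Fin d → ℝ × ℝ) :=
  {w | |N1 w - d| ≤ δ * d ∧ |N2 w - d| ≤ δ * d ∧ |NC w - ρ * d| ≤ δ * d}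

lemma meas_E (d : ℕ) (ρ δ : ℝ) : MeasurableSet (Eset d ρ δ) := by
  have e1 : Measurable (fun w : Fin d → ℝ × ℝ => N1 w) := by unfold N1; fun_prop
  have e2 : Measurable (fun w : Fin d → ℝ × ℝ => N2 w) := by unfold N2; fun_prop
  have e3 : Measurable (fun w : Fin d → ℝ × ℝ => NC w) := by unfold NC; fun_prop
  refine MeasurableSet.inter ?_ (MeasurableSet.inter ?_ ?_)
  · exact measurableSet_le (continuous_abs.measurable.comp (e1.sub_const _)) measurable_const
  · exact measurableSet_le (continuous_abs.measurable.comp (e2.sub_const _)) measurable_const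
  · exact measurableSet_le (continuous_abs.measurable.comp (e3.sub_const _)) measurable_const

lemma E_inv (d : ℕ) (ρ δ : ℝ) : ∀ A ∈ Matrix.orthogonalGroup (Fin d) ℝ, ∀ w,
    act A w ∈ Eset d ρ δ ↔ w ∈ Eset d ρ δ := by
  intro A hA w
  simp only [Eset, Set.mem_ofPred_eq, N1_act A hA, N2_act A hA, NC_act A hA]

lemma E_facts (n : ℕ) (ρ δ : ℝ) (hδ : 0 < δ) (h1 : δ < ρ) (h2 : ρ + 2 * δ < 1)
    (w : Fin (n+2) → ℝ × ℝ) (hw : w ∈ Eset (n+2) ρ δ) :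
    0 < N1 w ∧ NC w ^ 2 < N1 w * N2 w ∧ 0 ≤ NC w ∧
    N1 w * N2 w ≤ ((n+2 : ℝ) * (1 + δ)) ^ 2 ∧ ((n+2 : ℝ) * (1 - δ)) ^ 2 ≤ N1 w * N2 w ∧
    NC w ≤ (n+2 : ℝ) * (ρ + δ) ∧ (n+2 : ℝ) * (ρ - δ) ≤ NC w := by
  obtain ⟨a, b, c⟩ := hw
  rw [abs_le] at a b c
  push_cast at a b c
  have hd : (0 : ℝ) < n + 2 := by positivity
  set D : ℝ := n + 2
  have a1 : D * (1 - δ) ≤ N1 w := by linarith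
  have a2 : N1 w ≤ D * (1 + δ) := by linarith
  have b1 : D * (1 - δ) ≤ N2 w := by linarith
  have b2 : N2 w ≤ D * (1 + δ) := by linarith
  have c1 : D * (ρ - δ) ≤ NC w := by linarith
  have c2 : NC w ≤ D * (ρ + δ) := by linarith
  have p1 : 0 < D * (1 - δ) := mul_pos hd (by linarith)
  have p2 : 0 < D * (ρ - δ) := mul_pos hd (by linarith)
  have p3 : D * (ρ + δ) < D * (1 - δ) := mul_lt_mul_of_pos_left (by linarith) hd
  have hlow : (D * (1 - δ)) ^ 2 ≤ N1 w * N2 w := by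
    rw [sq]; exact mul_le_mul a1 b1 p1.le (by linarith)
  refine ⟨by linarith, ?_, by linarith, ?_, hlow, c2, c1⟩
  · refine lt_of_lt_of_le ?_ hlow
    exact pow_lt_pow_left₀ (by linarith) (by linarith) (by norm_num)
  · rw [sq]; exact mul_le_mul a2 b2 (by linarith) (by linarith)

lemma upper_p (n : ℕ) (μ : Measure (Matrix.orthogonalGroup (Fin (n+2)) ℝ)) [μ.IsHaarMeasure]
    [IsProbabilityMeasure μ] (θ : ℝ) (hs : 0 < sin θ) (hc : 0 < cos θ) (ρ δ : ℝ) (hδ : 0 < δ)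
    (h1 : δ < ρ) (h2 : ρ + 2 * δ < 1) (h3 : cos θ * (1 + δ) ≤ ρ - δ) :
    μ (collisionEvent (n+2) θ) * volume (Eset (n+2) ρ δ)
      ≤ volume (Eset (n+2) ρ δ ∩ Qset (n+2)) := by
  rw [fubini_id n μ _ (meas_E _ _ _) (E_inv _ _ _), ← setLIntegral_const]
  refine setLIntegral_mono_ae' (meas_E _ _ _) (ae_of_all _ fun w hw => ?_)
  obtain ⟨a, b, c, e, f, g, h⟩ := E_facts n ρ δ hδ h1 h2 w hw
  refine coll_le n μ θ hs hc w a b c ?_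
  have hd : (0 : ℝ) < n + 2 := by positivity
  calc cos θ ^ 2 * (N1 w * N2 w) ≤ cos θ ^ 2 * ((n+2 : ℝ) * (1 + δ)) ^ 2 := by gcongr
    _ = ((n+2 : ℝ) * (cos θ * (1 + δ))) ^ 2 := by ring
    _ ≤ ((n+2 : ℝ) * (ρ - δ)) ^ 2 := by gcongr
    _ ≤ NC w ^ 2 := by
      have : 0 ≤ (n+2 : ℝ) * (ρ - δ) := mul_nonneg hd.le (by linarith)
      gcongr

lemma lower_p (n : ℕ) (μ : Measure (Matrix.orthogonalGroup (Fin (n+2)) ℝ)) [μ.IsHaarMeasure]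
    [IsProbabilityMeasure μ] (θ : ℝ) (hs : 0 < sin θ) (hc : 0 < cos θ) (ρ δ : ℝ) (hδ : 0 < δ)
    (h1 : δ < ρ) (h2 : ρ + 2 * δ < 1) (h3 : ρ + δ ≤ cos θ * (1 - δ)) :
    volume (Eset (n+2) ρ δ ∩ Qset (n+2))
      ≤ μ (collisionEvent (n+2) θ) * volume (Eset (n+2) ρ δ) := by
  rw [fubini_id n μ _ (meas_E _ _ _) (E_inv _ _ _), ← setLIntegral_const]
  refine setLIntegral_mono_ae' (meas_E _ _ _) (ae_of_all _ fun w hw => ?_)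
  obtain ⟨a, b, c, e, f, g, h⟩ := E_facts n ρ δ hδ h1 h2 w hw
  refine le_coll n μ θ hs hc w a b c ?_
  have hd : (0 : ℝ) < n + 2 := by positivity
  calc NC w ^ 2 ≤ ((n+2 : ℝ) * (ρ + δ)) ^ 2 := by gcongr
    _ ≤ ((n+2 : ℝ) * (cos θ * (1 - δ))) ^ 2 := by gcongr; nlinarith
    _ = cos θ ^ 2 * ((n+2 : ℝ) * (1 - δ)) ^ 2 := by ring
    _ ≤ _ := by gcongr

def gw (α γ : ℝ) (p : ℝ × ℝ) : ℝ := exp (-(α * (p.1 ^ 2 + p.2 ^ 2) + γ * (p.1 * p.2)))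

lemma gw_pos (α γ : ℝ) (p : ℝ × ℝ) : 0 < gw α γ p := exp_pos _

lemma gw_meas (α γ : ℝ) : Measurable (gw α γ) := by unfold gw; fun_prop

lemma gw_int (α γ : ℝ) (h : |γ| < 2 * α) (a b : ℕ) :
    Integrable (fun p : ℝ × ℝ => p.1 ^ a * p.2 ^ b * gw α γ p) := by
  have hc : 0 < α - |γ| / 2 := by linarith
  set c := α - |γ| / 2 with hcdef
  have key : ∀ a : ℕ, Integrable (fun x : ℝ => x ^ a * exp (-c * x ^ 2)) := by
    intro a
    have := integrable_rpow_mul_exp_neg_mul_sq hc (s := (a : ℝ)) (by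
      have : (0:ℝ) ≤ a := by positivity
      linarith)
    simpa using this
  have h2 := (key a).mul_prod (key b)
  refine h2.norm.mono' ?_ (ae_of_all _ fun p => ?_)
  · exact (((measurable_fst.pow_const a).mul (measurable_snd.pow_const b)).mul
      (gw_meas α γ)).aestronglyMeasurable
  · simp only [norm_mul]
    have hk : ‖gw α γ p‖ ≤ ‖exp (-c * p.1 ^ 2)‖ * ‖exp (-c * p.2 ^ 2)‖ := by
      rw [Real.norm_of_nonneg (gw_pos _ _ _).le, Real.norm_of_nonneg (exp_pos _).le,
        Real.norm_of_nonneg (exp_pos _).le, ← Real.exp_add]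
      apply Real.exp_le_exp.2
      have h3 : -(γ * (p.1 * p.2)) ≤ |γ| * (|p.1| * |p.2|) := by
        rw [← abs_mul, ← abs_mul]; exact neg_le_abs _
      have h4 : |γ| * (2 * (|p.1| * |p.2|)) ≤ |γ| * (p.1 ^ 2 + p.2 ^ 2) := by
        refine mul_le_mul_of_nonneg_left ?_ (abs_nonneg _)
        nlinarith [sq_nonneg (|p.1| - |p.2|), sq_abs p.1, sq_abs p.2]
      rw [hcdef]
      nlinarith
    calc ‖p.1 ^ a‖ * ‖p.2 ^ b‖ * ‖gw α γ p‖
        ≤ ‖p.1 ^ a‖ * ‖p.2 ^ b‖ * (‖exp (-c * p.1 ^ 2)‖ * ‖exp (-c * p.2 ^ 2)‖) := by gcongr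
      _ = _ := by ring

lemma sum_q {d : ℕ} (α γ : ℝ) (w : Fin d → ℝ × ℝ) :
    ∏ i, gw α γ (w i) = exp (-(α * (N1 w + N2 w) + γ * NC w)) := by
  unfold gw
  rw [← Real.exp_sum]
  congr 1
  rw [Finset.sum_neg_distrib, Finset.sum_add_distrib, ← Finset.mul_sum, ← Finset.mul_sum,
    Finset.sum_add_distrib]
  rfl

lemma q_bounds {d : ℕ} (α γ ρ δ : ℝ) (w : Fin d → ℝ × ℝ) (hw : w ∈ Eset d ρ δ) :
    |α * (N1 w + N2 w) + γ * NC w - d * (2 * α + γ * ρ)| ≤ d * ((2 * |α| + |γ|) * δ) := by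
  obtain ⟨a, b, c⟩ := hw
  have : α * (N1 w + N2 w) + γ * NC w - d * (2 * α + γ * ρ)
    = α * (N1 w - d) + α * (N2 w - d) + γ * (NC w - ρ * d) := by ring
  rw [this]
  calc _ ≤ |α * (N1 w - d)| + |α * (N2 w - d)| + |γ * (NC w - ρ * d)| := abs_add_three _ _ _
    _ ≤ |α| * (δ * d) + |α| * (δ * d) + |γ| * (δ * d) := by
      rw [abs_mul, abs_mul, abs_mul]; gcongr
    _ = _ := by ring

def Sd (d : ℕ) (S : Set (ℝ × ℝ)) : Set (Fin d → ℝ × ℝ) := {w | ∀ i, w i ∈ S}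

lemma vol_upper (d : ℕ) (α γ ρ δ : ℝ) (h : |γ| < 2 * α) (S : Set (ℝ × ℝ)) (hS : MeasurableSet S) :
    volume (Eset d ρ δ ∩ Sd d S) ≤
      ENNReal.ofReal (exp (d * (2 * α + γ * ρ + (2 * |α| + |γ|) * δ)) * (∫ p in S, gw α γ p) ^ d) := by
  set K := exp (d * (2 * α + γ * ρ + (2 * |α| + |γ|) * δ))
  let G : ℝ × ℝ → ℝ := S.indicator (gw α γ)
  have hG0 : ∀ p, 0 ≤ G p := fun p => Set.indicator_nonneg (fun _ _ => (gw_pos _ _ _).le) _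
  have hGi : Integrable G := by
    have := gw_int α γ h 0 0
    simp only [pow_zero, one_mul] at this
    exact this.indicator hS
  have e1 : ∫ p in S, gw α γ p = ∫ p, G p := (integral_indicator hS).symm
  have e2 : (∫ p, G p) ^ d = ∫ w : Fin d → ℝ × ℝ, ∏ i, G (w i) := by
    rw [integral_fintype_prod_volume_eq_pow]; simp
  have hi : Integrable (fun w : Fin d → ℝ × ℝ => ∏ i, G (w i)) :=
    Integrable.fintype_prod (f := fun _ => G) (fun _ => hGi)
  rw [e1, e2, ← integral_const_mul, ofReal_integral_eq_lintegral_ofReal (hi.const_mul _)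
    (ae_of_all _ fun w => mul_nonneg (exp_pos _).le (Finset.prod_nonneg fun i _ => hG0 _))]
  have hM : MeasurableSet (Eset d ρ δ ∩ Sd d S) := by
    refine (meas_E _ _ _).inter ?_
    have : Sd d S = ⋂ i, (fun w : Fin d → ℝ × ℝ => w i) ⁻¹' S := by ext; simp [Sd]
    rw [this]
    exact MeasurableSet.iInter fun i => measurable_pi_apply i hS
  rw [← lintegral_indicator_one hM]
  refine lintegral_mono fun w => ?_
  by_cases hw : w ∈ Eset d ρ δ ∩ Sd d S
  · rw [Set.indicator_of_mem hw]
    have hGp : ∏ i, G (w i) = ∏ i, gw α γ (w i) :=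
      Finset.prod_congr rfl fun i _ => Set.indicator_of_mem (hw.2 i) _
    rw [hGp, sum_q, ← Real.exp_add]
    simp only [Pi.one_apply]
    rw [ENNReal.one_le_ofReal]
    apply Real.one_le_exp
    have := (abs_le.1 (q_bounds α γ ρ δ w hw.1)).2
    linarith
  · rw [Set.indicator_of_notMem hw]; exact zero_le

lemma pi_withDensity' (d : ℕ) (G : ℝ × ℝ → ℝ) (h0 : ∀ p, 0 ≤ G p)
    (hi : Integrable G) :
    Measure.pi (fun _ : Fin d => (volume : Measure (ℝ × ℝ)).withDensity (fun p => ENNReal.ofReal (G p)))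
      = (volume : Measure (Fin d → ℝ × ℝ)).withDensity (fun w => ENNReal.ofReal (∏ i, G (w i))) := by
  have : IsFiniteMeasure ((volume : Measure (ℝ × ℝ)).withDensity (fun p => ENNReal.ofReal (G p))) :=
    isFiniteMeasure_withDensity_ofReal hi.2
  refine Measure.pi_eq fun s hs => ?_
  have hms : MeasurableSet (Set.univ.pi s) := MeasurableSet.univ_pi hs
  rw [withDensity_apply _ hms]
  have h1 : ∀ i, ∫⁻ p in s i, ENNReal.ofReal (G p) = ENNReal.ofReal (∫ p, (s i).indicator G p) := by
    intro i
    rw [integral_indicator (hs i), ofReal_integral_eq_lintegral_ofReal hi.integrableOn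
      (ae_of_all _ h0)]
  simp_rw [withDensity_apply _ (hs _), h1]
  rw [← ENNReal.ofReal_prod_of_nonneg (fun i _ => integral_nonneg fun p => Set.indicator_nonneg (fun _ _ => h0 _) _),
    ← integral_fintype_prod_volume_eq_prod (f := fun i => (s i).indicator G),
    ofReal_integral_eq_lintegral_ofReal (μ := (volume : Measure (Fin d → ℝ × ℝ)))
      (Integrable.fintype_prod_dep (fun i => hi.indicator (hs i)))
      (ae_of_all _ fun w => Finset.prod_nonneg fun i _ => Set.indicator_nonneg (fun _ _ => h0 _) _),
    ← lintegral_indicator hms]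
  refine lintegral_congr fun w => ?_
  by_cases hw : w ∈ Set.univ.pi s
  · rw [Set.indicator_of_mem hw]
    congr 1
    exact Finset.prod_congr rfl fun i _ => (Set.indicator_of_mem (hw i trivial) _).symm
  · rw [Set.indicator_of_notMem hw]
    simp only [Set.mem_pi, Set.mem_univ, true_implies, not_forall] at hw
    obtain ⟨i, hi'⟩ := hw
    rw [Finset.prod_eq_zero (Finset.mem_univ i) (Set.indicator_of_notMem hi' _)]
    simp

lemma cheb (ν : Measure (ℝ × ℝ)) [IsProbabilityMeasure ν] (h : ℝ × ℝ → ℝ) (hh : MemLp h 2 ν)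
    (m δ : ℝ) (hm : ∫ p, h p ∂ν = m) (hδ : 0 < δ) :
    Tendsto (fun d : ℕ => Measure.pi (fun _ : Fin d => ν) {w | δ * d < |∑ i, h (w i) - m * d|})
      atTop (nhds 0) := by
  have key : ∀ d : ℕ, 0 < d → Measure.pi (fun _ : Fin d => ν) {w | δ * d < |∑ i, h (w i) - m * d|}
      ≤ ENNReal.ofReal ((ProbabilityTheory.variance h ν / δ ^ 2) * ((d : ℝ))⁻¹) := by
    intro d hd
    have hd' : (0:ℝ) < d := by exact_mod_cast hd
    have hL : ∀ i : Fin d, MemLp (fun w : Fin d → ℝ × ℝ => h (w i)) 2 (Measure.pi (fun _ : Fin d => ν)) :=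
      fun i => hh.comp_measurePreserving (measurePreserving_eval _ i)
    have hX : MemLp (fun w : Fin d → ℝ × ℝ => ∑ i, h (w i)) 2 (Measure.pi (fun _ : Fin d => ν)) :=
      memLp_finsetSum _ fun i _ => hL i
    have hE : ∫ w, ∑ i, h (w i) ∂(Measure.pi (fun _ : Fin d => ν)) = m * d := by
      rw [integral_finsetSum _ fun i _ => (hL i).integrable (by norm_num)]
      simp_rw [fun i : Fin d => integral_comp_eval (μ := fun _ : Fin d => ν) (i := i) hh.aestronglyMeasurable]
      simp [hm, mul_comm]
    have hV : ProbabilityTheory.variance (fun w : Fin d → ℝ × ℝ => ∑ i, h (w i)) (Measure.pi (fun _ : Fin d => ν))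
        = d * ProbabilityTheory.variance h ν := by
      have := ProbabilityTheory.variance_sum_pi (μ := fun _ : Fin d => ν) (X := fun _ => h) (fun _ => hh)
      simp only [Finset.sum_const, Finset.card_univ, Fintype.card_fin, nsmul_eq_mul] at this
      rw [← this]
      congr 1
      ext w; simp
    have := ProbabilityTheory.meas_ge_le_variance_div_sq hX (c := δ * d) (by positivity)
    rw [hE, hV] at this
    refine (measure_mono fun w hw => ?_).trans (this.trans (le_of_eq ?_))
    · exact le_of_lt (show δ * d < |∑ i, h (w i) - m * d| from hw)
    · congr 1; field_simp
  have ht : Tendsto (fun d : ℕ => ENNReal.ofReal ((ProbabilityTheory.variance h ν / δ ^ 2) * ((d : ℝ))⁻¹))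
      atTop (nhds 0) := by
    rw [← ENNReal.ofReal_zero]
    refine ENNReal.tendsto_ofReal ?_
    simpa using (tendsto_inv_atTop_nhds_zero_nat (𝕜 := ℝ)).const_mul (ProbabilityTheory.variance h ν / δ ^ 2)
  refine tendsto_of_tendsto_of_tendsto_of_le_of_le' tendsto_const_nhds ht
    (Eventually.of_forall fun _ => zero_le) ?_
  filter_upwards [eventually_gt_atTop 0] with d hd using key d hd

lemma vol_lower (α γ ρ δ : ℝ) (h : |γ| < 2 * α) (S : Set (ℝ × ℝ)) (hS : MeasurableSet S)
    (hδ : 0 < δ) (hZ : 0 < ∫ p in S, gw α γ p)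
    (m1 : ∫ p in S, p.1 ^ 2 * gw α γ p = ∫ p in S, gw α γ p)
    (m2 : ∫ p in S, p.2 ^ 2 * gw α γ p = ∫ p in S, gw α γ p)
    (m3 : ∫ p in S, p.1 * p.2 * gw α γ p = ρ * ∫ p in S, gw α γ p) :
    ∀ᶠ d : ℕ in atTop, ENNReal.ofReal
      (2⁻¹ * (exp (d * (2 * α + γ * ρ - (2 * |α| + |γ|) * δ)) * (∫ p in S, gw α γ p) ^ d))
      ≤ volume (Eset d ρ δ ∩ Sd d S) := by
  set Z := ∫ p in S, gw α γ p with hZdef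
  let G : ℝ × ℝ → ℝ := fun p => Z⁻¹ * S.indicator (gw α γ) p
  have hG0 : ∀ p, 0 ≤ G p := fun p =>
    mul_nonneg (inv_nonneg.2 hZ.le) (Set.indicator_nonneg (fun _ _ => (gw_pos _ _ _).le) _)
  have hGm : Measurable G := ((gw_meas α γ).indicator hS).const_mul _
  have hGi : Integrable G := by
    have := gw_int α γ h 0 0
    simp only [pow_zero, one_mul] at this
    exact (this.indicator hS).const_mul _
  set ν : Measure (ℝ × ℝ) := volume.withDensity (fun p => ENNReal.ofReal (G p)) with hν
  have hint : ∀ f : ℝ × ℝ → ℝ, ∫ p, f p ∂ν = Z⁻¹ * ∫ p in S, f p * gw α γ p := by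
    intro f
    rw [hν, integral_withDensity_eq_integral_toReal_smul (by fun_prop)
      (ae_of_all _ fun _ => ENNReal.ofReal_lt_top), ← integral_indicator hS, ← integral_const_mul]
    refine integral_congr_ae (ae_of_all _ fun p => ?_)
    simp only [ENNReal.toReal_ofReal (hG0 p), smul_eq_mul, G]
    by_cases hp : p ∈ S
    · simp [hp]; ring
    · simp [hp]
  have hprob : IsProbabilityMeasure ν := by
    have : IsFiniteMeasure ν := isFiniteMeasure_withDensity_ofReal hGi.2
    have h1 := hint (fun _ => 1)
    simp only [one_mul, integral_const, smul_eq_mul, mul_one] at h1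
    rw [← hZdef, inv_mul_cancel₀ hZ.ne'] at h1
    constructor
    rw [← ENNReal.toReal_eq_one_iff]; exact h1
  have hmem : ∀ f : ℝ × ℝ → ℝ, Measurable f → Integrable (fun p => f p ^ 2 * gw α γ p) →
      MemLp f 2 ν := by
    intro f hf hfi
    rw [memLp_two_iff_integrable_sq hf.aestronglyMeasurable, hν,
      integrable_withDensity_iff (by fun_prop) (ae_of_all _ fun _ => ENNReal.ofReal_lt_top)]
    have : (fun p => f p ^ 2 * (ENNReal.ofReal (G p)).toReal)
        = fun p => Z⁻¹ * S.indicator (fun p => f p ^ 2 * gw α γ p) p := by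
      ext p
      simp only [ENNReal.toReal_ofReal (hG0 p), G]
      by_cases hp : p ∈ S
      · simp [hp]; ring
      · simp [hp]
    rw [this]
    exact (hfi.indicator hS).const_mul _
  have c1 := cheb ν (fun p => p.1 ^ 2) (hmem _ (by fun_prop) (by
    exact (gw_int α γ h 4 0).congr (ae_of_all _ fun p => by dsimp only; ring))) 1 δ (by
    rw [hint, m1, inv_mul_cancel₀ hZ.ne']) hδ
  have c2 := cheb ν (fun p => p.2 ^ 2) (hmem _ (by fun_prop) (by
    exact (gw_int α γ h 0 4).congr (ae_of_all _ fun p => by dsimp only; ring))) 1 δ (by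
    rw [hint, m2, inv_mul_cancel₀ hZ.ne']) hδ
  have c3 := cheb ν (fun p => p.1 * p.2) (hmem _ (by fun_prop) (by
    exact (gw_int α γ h 2 2).congr (ae_of_all _ fun p => by dsimp only; ring))) ρ δ (by
    rw [hint, m3]; field_simp) hδ
  have c := (c1.add c2).add c3
  simp only [add_zero] at c
  have ev := c.eventually (gt_mem_nhds (show (0 : ENNReal) < 2⁻¹ by simp))
  filter_upwards [ev] with d hd
  set P := Measure.pi (fun _ : Fin d => ν) with hP
  have hPE : 2⁻¹ ≤ P (Eset d ρ δ) := by
    have hsub : (Eset d ρ δ)ᶜ ⊆ ({w | δ * d < |∑ i, (w i).1 ^ 2 - 1 * d|} ∪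
        {w | δ * d < |∑ i, (w i).2 ^ 2 - 1 * d|}) ∪ {w | δ * d < |∑ i, (w i).1 * (w i).2 - ρ * d|} := by
      intro w hw
      by_contra hcon
      apply hw
      simp only [Set.mem_union, Set.mem_ofPred_eq, not_or, not_lt, one_mul] at hcon
      exact ⟨hcon.1.1, hcon.1.2, hcon.2⟩
    have h1 : P (Eset d ρ δ)ᶜ ≤ 2⁻¹ := by
      refine (measure_mono hsub).trans (((measure_union_le _ _).trans
        (add_le_add_left (measure_union_le _ _) _)).trans hd.le)
    have h2 := prob_add_prob_compl (μ := P) (meas_E d ρ δ)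
    by_contra hcon
    push Not at hcon
    have h3 := ENNReal.add_lt_add_of_lt_of_le (by finiteness) hcon h1
    rw [h2, ENNReal.inv_two_add_inv_two] at h3
    exact lt_irrefl _ h3
  have hZd : 0 < Z ^ d := pow_pos hZ d
  set K := exp (d * (2 * α + γ * ρ - (2 * |α| + |γ|) * δ)) with hK
  have hKp : 0 < K := exp_pos _
  have hPv : P (Eset d ρ δ) ≤ ENNReal.ofReal ((K * Z ^ d)⁻¹) * volume (Eset d ρ δ ∩ Sd d S) := by
    have hM : MeasurableSet (Eset d ρ δ ∩ Sd d S) := by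
      refine (meas_E _ _ _).inter ?_
      have : Sd d S = ⋂ i, (fun w : Fin d → ℝ × ℝ => w i) ⁻¹' S := by ext; simp [Sd]
      rw [this]
      exact MeasurableSet.iInter fun i => measurable_pi_apply i hS
    rw [hP, hν, pi_withDensity' d G hG0 hGi, withDensity_apply _ (meas_E _ _ _),
      ← setLIntegral_const, ← lintegral_indicator hM, ← lintegral_indicator (meas_E _ _ _)]
    refine lintegral_mono fun w => ?_
    by_cases hwE : w ∈ Eset d ρ δ
    · by_cases hwS : w ∈ Sd d S
      · rw [Set.indicator_of_mem hwE, Set.indicator_of_mem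
          (show w ∈ Eset d ρ δ ∩ Sd d S from ⟨hwE, hwS⟩)]
        apply ENNReal.ofReal_le_ofReal
        have hGp : ∏ i, G (w i) = (Z ^ d)⁻¹ * ∏ i, gw α γ (w i) := by
          simp only [G, Finset.prod_mul_distrib]
          congr 1
          · simp
          · exact Finset.prod_congr rfl fun i _ => Set.indicator_of_mem (hwS i) _
        rw [hGp, sum_q, mul_inv, mul_comm]
        refine mul_le_mul_of_nonneg_right ?_ (by positivity)
        rw [hK, ← Real.exp_neg]
        apply Real.exp_le_exp.2
        have := (abs_le.1 (q_bounds α γ ρ δ w hwE)).1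
        linarith
      · rw [Set.indicator_of_mem hwE]
        simp only [Sd, Set.mem_ofPred_eq, not_forall] at hwS
        obtain ⟨i, hi⟩ := hwS
        rw [Finset.prod_eq_zero (Finset.mem_univ i)]
        · simp
        · simp [G, hi]
    · rw [Set.indicator_of_notMem hwE]; exact zero_le
  have hKZ : 0 < K * Z ^ d := mul_pos hKp hZd
  calc ENNReal.ofReal (2⁻¹ * (K * Z ^ d)) = ENNReal.ofReal (K * Z ^ d) * 2⁻¹ := by
        rw [mul_comm, ENNReal.ofReal_mul hKZ.le, ENNReal.ofReal_inv_of_pos (by norm_num)]; simp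
    _ ≤ ENNReal.ofReal (K * Z ^ d) * (ENNReal.ofReal ((K * Z ^ d)⁻¹) * volume (Eset d ρ δ ∩ Sd d S)) := by
        gcongr; exact hPE.trans hPv
    _ = _ := by
        rw [← mul_assoc, ← ENNReal.ofReal_mul hKZ.le, mul_inv_cancel₀ hKZ.ne']; simp

def vv (s φ : ℝ) : ℝ × ℝ := (sin (s - φ) / sin s, sin φ / sin s)

def Lm (s : ℝ) : (ℝ × ℝ) →ₗ[ℝ] (ℝ × ℝ) :=
  Matrix.toLin (Module.Basis.finTwoProd ℝ) (Module.Basis.finTwoProd ℝ) !![1, -(cos s / sin s); 0, (sin s)⁻¹]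

lemma Lm_apply (s : ℝ) (z : ℝ × ℝ) : Lm s z = (z.1 - cos s / sin s * z.2, (sin s)⁻¹ * z.2) := by
  simp [Lm, Matrix.toLin_finTwoProd_apply]
  ring

lemma Lm_det (s : ℝ) : LinearMap.det (Lm s) = (sin s)⁻¹ := by
  simp [Lm, LinearMap.det_toLin, Matrix.det_fin_two]

lemma integral_L (s : ℝ) (hs : 0 < sin s) (F : ℝ × ℝ → ℝ) (hF : Measurable F) :
    ∫ p, F p = (sin s)⁻¹ * ∫ z, F (Lm s z) := by
  have hd : LinearMap.det (Lm s) ≠ 0 := by rw [Lm_det]; positivity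
  have h := Measure.map_linearMap_addHaar_eq_smul_addHaar (volume : Measure (ℝ × ℝ)) hd
  have h2 : ∫ z, F (Lm s z) = ∫ p, F p ∂(Measure.map (Lm s) volume) :=
    (integral_map (Lm s).continuous_of_finiteDimensional.aemeasurable
      hF.aestronglyMeasurable).symm
  rw [h2, h, integral_smul_measure, Lm_det, inv_inv, abs_of_pos hs, ENNReal.toReal_ofReal hs.le,
    smul_eq_mul, inv_mul_cancel_left₀ hs.ne']

lemma polar_main (s a : ℝ) (hs : 0 < sin s) (S : Set (ℝ × ℝ)) (hS : MeasurableSet S)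
    (hcone : ∀ r : ℝ, 0 < r → ∀ p : ℝ × ℝ, r • p ∈ S ↔ p ∈ S) (h : ℝ × ℝ → ℝ) (hh : Measurable h)
    (k : ℕ) (hk : ∀ r : ℝ, 0 < r → ∀ p : ℝ × ℝ, h (r • p) = r ^ k * h p) :
    ∫ p in S, h p * gw (a / 2) (a * cos s) p = (sin s)⁻¹ *
      ((∫ r in Set.Ioi (0:ℝ), r ^ (k+1) * exp (-(a / 2) * r ^ 2)) *
        ∫ φ in Set.Ioo (-π) π, S.indicator h (vv s φ)) := by
  have hm : Measurable (fun p => h p * gw (a / 2) (a * cos s) p) := hh.mul (gw_meas _ _)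
  rw [← integral_indicator hS, integral_L s hs _ (hm.indicator hS),
    ← integral_comp_polarCoord_symm]
  congr 1
  rw [← setIntegral_prod_mul]
  rw [polarCoord_target]
  refine setIntegral_congr_fun (measurableSet_Ioi.prod measurableSet_Ioo) fun p hp => ?_
  have hr : 0 < p.1 := hp.1
  have e : Lm s (polarCoord.symm p) = p.1 • vv s p.2 := by
    rw [Lm_apply, polarCoord_symm_apply]
    simp only [vv, Prod.smul_mk, smul_eq_mul, sin_sub]
    ext <;> simp <;> field_simp
  have eg : gw (a / 2) (a * cos s) (p.1 • vv s p.2) = exp (-(a / 2) * p.1 ^ 2) := by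
    unfold gw
    congr 1
    simp only [vv, Prod.smul_mk, smul_eq_mul, sin_sub]
    have h1 := sin_sq_add_cos_sq s
    have h2 := sin_sq_add_cos_sq p.2
    have h3 : cos s ^ 2 = 1 - sin s ^ 2 := by linarith
    have h4 : cos p.2 ^ 2 = 1 - sin p.2 ^ 2 := by linarith
    field_simp
    ring_nf
    rw [h3, h4]
    ring
  rw [e, smul_eq_mul]
  by_cases hv : vv s p.2 ∈ S
  · rw [Set.indicator_of_mem ((hcone _ hr _).2 hv), Set.indicator_of_mem hv, eg, hk _ hr]
    ring
  · rw [Set.indicator_of_notMem (fun hc => hv ((hcone _ hr _).1 hc)), Set.indicator_of_notMem hv]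
    simp

lemma rad0 (a : ℝ) (ha : 0 < a) : ∫ r in Set.Ioi (0:ℝ), r ^ (0+1) * exp (-(a / 2) * r ^ 2) = 1 / a := by
  have := integral_rpow_mul_exp_neg_mul_rpow (p := 2) (q := 1) (b := a / 2) (by norm_num) (by norm_num) (by positivity)
  norm_num at this
  simp only [zero_add, pow_one, neg_mul]
  rw [this]
  try rw [Real.rpow_neg_one]
  field_simp

lemma rad2 (a : ℝ) (ha : 0 < a) : ∫ r in Set.Ioi (0:ℝ), r ^ (2+1) * exp (-(a / 2) * r ^ 2) = 2 / a ^ 2 := by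
  have := integral_rpow_mul_exp_neg_mul_rpow (p := 2) (q := 3) (b := a / 2) (by norm_num) (by norm_num) (by positivity)
  norm_num at this
  have e : ∀ r : ℝ, r ^ (2 + 1) = r ^ (3:ℝ) := fun r => by norm_cast
  simp only [e]
  norm_num
  rw [this]
  field_simp

lemma ang1 (s u v : ℝ) (hs : sin s ≠ 0) : ∫ φ in u..v, (vv s φ).1 ^ 2 =
    (v / 2 + sin (s - v) * cos (s - v) / 2 - (u / 2 + sin (s - u) * cos (s - u) / 2)) / sin s ^ 2 := by
  have h : ∀ x ∈ Set.uIcc u v, HasDerivAt (fun φ => (φ / 2 + sin (s - φ) * cos (s - φ) / 2) / sin s ^ 2)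
      ((vv s x).1 ^ 2) x := by
    intro x _
    have h0 : HasDerivAt (fun φ : ℝ => s - φ) (-1) x := by simpa using (hasDerivAt_id x).const_sub s
    have h1 := (((hasDerivAt_id x).div_const 2).add ((h0.sin.mul h0.cos).div_const 2)).div_const (sin s ^ 2)
    refine h1.congr_deriv ?_
    have := sin_sq_add_cos_sq (s - x)
    simp only [vv]
    field_simp
    linarith
  rw [intervalIntegral.integral_eq_sub_of_hasDerivAt h
    (Continuous.intervalIntegrable (by unfold vv; fun_prop) _ _)]
  ring

lemma ang2 (s u v : ℝ) (hs : sin s ≠ 0) : ∫ φ in u..v, (vv s φ).2 ^ 2 =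
    (v / 2 - sin v * cos v / 2 - (u / 2 - sin u * cos u / 2)) / sin s ^ 2 := by
  have h : ∀ x ∈ Set.uIcc u v, HasDerivAt (fun φ => (φ / 2 - sin φ * cos φ / 2) / sin s ^ 2)
      ((vv s x).2 ^ 2) x := by
    intro x _
    have h1 := (((hasDerivAt_id x).div_const 2).sub (((hasDerivAt_sin x).mul (hasDerivAt_cos x)).div_const 2)).div_const (sin s ^ 2)
    refine h1.congr_deriv ?_
    have := sin_sq_add_cos_sq x
    simp only [vv]
    field_simp
    linarith
  rw [intervalIntegral.integral_eq_sub_of_hasDerivAt h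
    (Continuous.intervalIntegrable (by unfold vv; fun_prop) _ _)]
  ring

lemma ang3 (s u v : ℝ) (hs : sin s ≠ 0) : ∫ φ in u..v, (vv s φ).1 * (vv s φ).2 =
    ((-(v * cos s / 2) - sin (s - 2 * v) / 4) - (-(u * cos s / 2) - sin (s - 2 * u) / 4)) / sin s ^ 2 := by
  have h : ∀ x ∈ Set.uIcc u v, HasDerivAt (fun φ => (-(φ * cos s / 2) - sin (s - 2 * φ) / 4) / sin s ^ 2)
      ((vv s x).1 * (vv s x).2) x := by
    intro x _
    have h0 : HasDerivAt (fun φ : ℝ => s - 2 * φ) (-2) x := by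
      simpa using ((hasDerivAt_id x).const_mul 2).const_sub s
    have h1 := (((((hasDerivAt_id x).mul_const (cos s)).div_const 2).neg).sub (h0.sin.div_const 4)).div_const (sin s ^ 2)
    refine h1.congr_deriv ?_
    have := sin_sq_add_cos_sq x
    simp only [vv, sin_sub, cos_sub, cos_two_mul, sin_two_mul]
    have h3 : cos x ^ 2 = 1 - sin x ^ 2 := by linarith
    field_simp
    rw [h3]
    ring
  rw [intervalIntegral.integral_eq_sub_of_hasDerivAt h
    (Continuous.intervalIntegrable (by unfold vv; fun_prop) _ _)]
  ring

def Q1 : Set (ℝ × ℝ) := {p | sgn p.1 = sgn p.2}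

lemma Q1_meas : MeasurableSet Q1 :=
  measurableSet_eq_fun (meas_sgn.comp measurable_fst) (meas_sgn.comp measurable_snd)

lemma Q1_cone (r : ℝ) (hr : 0 < r) (p : ℝ × ℝ) : r • p ∈ Q1 ↔ p ∈ Q1 := by
  simp [Q1, sgn_pos_mul hr]

lemma sgn_of_pos {t : ℝ} (h : 0 < t) : sgn t = 1 := by simp [sgn, h.le]
lemma sgn_of_neg {t : ℝ} (h : t < 0) : sgn t = -1 := by simp [sgn, h]

lemma ang_Q (s : ℝ) (h0 : 0 < s) (h1 : s < π) (h : ℝ × ℝ → ℝ) (hc : Continuous (fun φ => h (vv s φ))) :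
    ∫ φ in Set.Ioo (-π) π, Q1.indicator h (vv s φ) =
      (∫ φ in (0:ℝ)..s, h (vv s φ)) + ∫ φ in (-π)..(s - π), h (vv s φ) := by
  have hss : 0 < sin s := sin_pos_of_pos_of_lt_pi h0 h1
  have hsub : Set.Ioo 0 s ∪ Set.Ioo (-π) (s - π) ⊆ Set.Ioo (-π) π := by
    rintro x (⟨a, b⟩ | ⟨a, b⟩) <;> constructor <;> linarith
  have hm : MeasurableSet (Set.Ioo 0 s ∪ Set.Ioo (-π) (s - π)) :=
    measurableSet_Ioo.union measurableSet_Ioo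
  have key : ∫ φ in Set.Ioo (-π) π, Q1.indicator h (vv s φ) =
      ∫ φ in Set.Ioo (-π) π, (Set.Ioo 0 s ∪ Set.Ioo (-π) (s - π)).indicator (fun φ => h (vv s φ)) φ := by
    refine setIntegral_congr_ae measurableSet_Ioo ?_
    have hn : ∀ c : ℝ, ∀ᵐ x : ℝ, x ≠ c := fun c => by
      rw [ae_iff]; simp
    filter_upwards [hn 0, hn s, hn (s - π)] with x n0 ns np hx
    have hiff : vv s x ∈ Q1 ↔ x ∈ Set.Ioo 0 s ∪ Set.Ioo (-π) (s - π) := by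
      have e1 : ∀ {t : ℝ}, 0 < t → sgn (t / sin s) = 1 := fun ht => sgn_of_pos (div_pos ht hss)
      have e2 : ∀ {t : ℝ}, t < 0 → sgn (t / sin s) = -1 := fun ht => sgn_of_neg (div_neg_of_neg_of_pos ht hss)
      simp only [Q1, vv, Set.mem_ofPred_eq, Set.mem_union, Set.mem_Ioo]
      obtain ⟨hx1, hx2⟩ := hx
      rcases lt_or_gt_of_ne n0 with c0 | c0
      · have s2 : sin x < 0 := sin_neg_of_neg_of_neg_pi_lt c0 hx1
        rcases lt_or_gt_of_ne np with c1 | c1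
        · have s1 : sin (s - x) < 0 := by
            have : sin (s - x) = - sin (s - x - π) := by rw [sin_sub_pi]; ring
            rw [this]
            have := sin_pos_of_pos_of_lt_pi (x := s - x - π) (by linarith) (by linarith)
            linarith
          rw [e2 s1, e2 s2]
          simp [hx1, c1]
        · have s1 : 0 < sin (s - x) := sin_pos_of_pos_of_lt_pi (by linarith) (by linarith)
          rw [e1 s1, e2 s2]
          constructor
          · intro hh; norm_num at hh
          · rintro (hh | hh) <;> linarith [hh.1, hh.2]
      · have s2 : 0 < sin x := sin_pos_of_pos_of_lt_pi c0 hx2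
        rcases lt_or_gt_of_ne ns with c1 | c1
        · have s1 : 0 < sin (s - x) := sin_pos_of_pos_of_lt_pi (by linarith) (by linarith)
          rw [e1 s1, e1 s2]
          simp [c0, c1]
        · have s1 : sin (s - x) < 0 := sin_neg_of_neg_of_neg_pi_lt (by linarith) (by linarith)
          rw [e2 s1, e1 s2]
          constructor
          · intro hh; norm_num at hh
          · rintro (hh | hh) <;> linarith [hh.1, hh.2]
    by_cases hv : vv s x ∈ Q1
    · rw [Set.indicator_of_mem hv, Set.indicator_of_mem (hiff.1 hv)]
    · rw [Set.indicator_of_notMem hv, Set.indicator_of_notMem (fun hh => hv (hiff.2 hh))]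
  rw [key, setIntegral_indicator hm, Set.inter_eq_self_of_subset_right hsub,
    setIntegral_union _ measurableSet_Ioo,
    intervalIntegral.integral_of_le h0.le, intervalIntegral.integral_of_le (by linarith),
    integral_Ioc_eq_integral_Ioo, integral_Ioc_eq_integral_Ioo]
  · exact (hc.integrableOn_Icc).mono_set Set.Ioo_subset_Icc_self
  · exact (hc.integrableOn_Icc).mono_set Set.Ioo_subset_Icc_self
  · rw [Set.disjoint_left]
    rintro x ⟨a, b⟩ ⟨c, d⟩
    linarith

lemma ang_U (s : ℝ) (h : ℝ × ℝ → ℝ) :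
    ∫ φ in Set.Ioo (-π) π, (Set.univ : Set (ℝ × ℝ)).indicator h (vv s φ) =
      ∫ φ in (-π)..π, h (vv s φ) := by
  rw [intervalIntegral.integral_of_le (by linarith [pi_pos]), integral_Ioc_eq_integral_Ioo]
  simp

lemma vv_cont (s : ℝ) : Continuous (vv s) := by unfold vv; fun_prop

/-- moments over a cone -/
lemma mom (s a : ℝ) (hs : 0 < sin s) (ha : 0 < a) (S : Set (ℝ × ℝ)) (hS : MeasurableSet S)
    (hcone : ∀ r : ℝ, 0 < r → ∀ p : ℝ × ℝ, r • p ∈ S ↔ p ∈ S) :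
    (∫ p in S, gw (a / 2) (a * cos s) p = (sin s)⁻¹ * (1 / a *
      ∫ φ in Set.Ioo (-π) π, S.indicator (fun _ => 1) (vv s φ))) ∧
    (∫ p in S, p.1 ^ 2 * gw (a / 2) (a * cos s) p = (sin s)⁻¹ * (2 / a ^ 2 *
      ∫ φ in Set.Ioo (-π) π, S.indicator (fun p => p.1 ^ 2) (vv s φ))) ∧
    (∫ p in S, p.2 ^ 2 * gw (a / 2) (a * cos s) p = (sin s)⁻¹ * (2 / a ^ 2 *
      ∫ φ in Set.Ioo (-π) π, S.indicator (fun p => p.2 ^ 2) (vv s φ))) ∧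
    (∫ p in S, p.1 * p.2 * gw (a / 2) (a * cos s) p = (sin s)⁻¹ * (2 / a ^ 2 *
      ∫ φ in Set.Ioo (-π) π, S.indicator (fun p => p.1 * p.2) (vv s φ))) := by
  refine ⟨?_, ?_, ?_, ?_⟩
  · have := polar_main s a hs S hS hcone (fun _ => 1) measurable_const 0 (by intros; simp)
    rw [rad0 a ha] at this
    simpa only [one_mul] using this
  · have := polar_main s a hs S hS hcone (fun p => p.1 ^ 2) (by fun_prop) 2
      (by intros; simp; ring)
    rwa [rad2 a ha] at this
  · have := polar_main s a hs S hS hcone (fun p => p.2 ^ 2) (by fun_prop) 2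
      (by intros; simp; ring)
    rwa [rad2 a ha] at this
  · have := polar_main s a hs S hS hcone (fun p => p.1 * p.2) (by fun_prop) 2
      (by intros; simp; ring)
    rwa [rad2 a ha] at this

def mm (s : ℝ) : ℝ := (s - sin s * cos s) / (s * sin s ^ 2)
def rh (s : ℝ) : ℝ := (sin s - s * cos s) / (s - sin s * cos s)
def ZQ (s : ℝ) : ℝ := 2 * s ^ 2 * sin s / (s - sin s * cos s)

lemma mom_Q (s : ℝ) (h0 : 0 < s) (h1 : s < π) (hD : 0 < s - sin s * cos s) :
    (∫ p in Q1, gw (mm s / 2) (mm s * cos s) p = ZQ s) ∧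
    (∫ p in Q1, p.1 ^ 2 * gw (mm s / 2) (mm s * cos s) p = ZQ s) ∧
    (∫ p in Q1, p.2 ^ 2 * gw (mm s / 2) (mm s * cos s) p = ZQ s) ∧
    (∫ p in Q1, p.1 * p.2 * gw (mm s / 2) (mm s * cos s) p = rh s * ZQ s) := by
  have hss : 0 < sin s := sin_pos_of_pos_of_lt_pi h0 h1
  have hm : 0 < mm s := by unfold mm; positivity
  obtain ⟨m0, m1, m2, m3⟩ := mom s (mm s) hss hm Q1 Q1_meas Q1_cone
  have c := vv_cont s
  rw [m0, m1, m2, m3, ang_Q s h0 h1 _ (by fun_prop), ang_Q s h0 h1 _ (by fun_prop),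
    ang_Q s h0 h1 _ (by fun_prop), ang_Q s h0 h1 _ (by fun_prop),
    ang1 s _ _ hss.ne', ang2 s _ _ hss.ne', ang3 s _ _ hss.ne', ang1 s _ _ hss.ne',
    ang2 s _ _ hss.ne', ang3 s _ _ hss.ne', intervalIntegral.integral_const,
    intervalIntegral.integral_const]
  have hD' := hD.ne'
  have hne := hss.ne'
  have hs' := h0.ne'
  have t1 : sin (s - 2 * s) = - sin s := by rw [← sin_neg]; congr 1; ring
  have t2 : sin (s - 2 * (s - π)) = - sin s := by
    rw [show s - 2 * (s - π) = -s + 2 * π by ring, sin_add_two_pi, sin_neg]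
  have t3 : sin (s - 2 * (-π)) = sin s := by
    rw [show s - 2 * (-π) = s + 2 * π by ring, sin_add_two_pi]
  have t4 : s - (s - π) = π := by ring
  have t5 : s - -π = s + π := by ring
  rw [t1, t2, t3, t4, t5]
  simp only [sub_self, sub_zero, mul_zero, sin_zero, cos_zero, sin_pi, cos_pi, sin_neg, cos_neg, smul_eq_mul,
    sin_add_pi, cos_add_pi, sin_sub_pi, cos_sub_pi]
  unfold ZQ rh mm
  refine ⟨?_, ?_, ?_, ?_⟩ <;> field_simp <;> ring

lemma mom_U (t : ℝ) (h0 : 0 < t) (h1 : t < π) :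
    (∫ p in Set.univ, gw (1 / sin t ^ 2 / 2) (1 / sin t ^ 2 * (-cos t)) p = 2 * π * sin t) ∧
    (∫ p in Set.univ, p.1 ^ 2 * gw (1 / sin t ^ 2 / 2) (1 / sin t ^ 2 * (-cos t)) p = 2 * π * sin t) ∧
    (∫ p in Set.univ, p.2 ^ 2 * gw (1 / sin t ^ 2 / 2) (1 / sin t ^ 2 * (-cos t)) p = 2 * π * sin t) ∧
    (∫ p in Set.univ, p.1 * p.2 * gw (1 / sin t ^ 2 / 2) (1 / sin t ^ 2 * (-cos t)) p
      = cos t * (2 * π * sin t)) := by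
  have hss : 0 < sin t := sin_pos_of_pos_of_lt_pi h0 h1
  have hss' : 0 < sin (π - t) := by rwa [sin_pi_sub]
  obtain ⟨m0, m1, m2, m3⟩ := mom (π - t) (1 / sin t ^ 2) hss' (by positivity) Set.univ
    MeasurableSet.univ (by intros; simp)
  rw [ang_U] at m0 m1 m2 m3
  rw [ang1 _ _ _ hss'.ne'] at m1
  rw [ang2 _ _ _ hss'.ne'] at m2
  rw [ang3 _ _ _ hss'.ne'] at m3
  rw [intervalIntegral.integral_const] at m0
  rw [cos_pi_sub] at m0 m1 m2 m3
  rw [m0, m1, m2, m3]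
  have t1 : sin (π - t - 2 * π) = - sin (π + t) := by
    rw [← sin_neg, show π - t - 2 * π = -(π + t) by ring]
  have t2 : sin (π - t - 2 * -π) = sin (π - t) := by
    rw [show π - t - 2 * -π = (π - t) + 2 * π by ring, sin_add_two_pi]
  have t4 : π - t - π = -t := by ring
  have t5 : π - t - -π = -t + 2 * π := by ring
  rw [t1, t2, t4, t5]
  have hne := hss.ne'
  simp only [sin_pi_sub, sin_add_two_pi, cos_add_two_pi, sin_pi, cos_pi, sin_neg, cos_neg,
    smul_eq_mul, add_comm π t, sin_add_pi]
  refine ⟨?_, ?_, ?_, ?_⟩ <;> field_simp <;> ring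

lemma ev_small {f g : ℝ → ℝ} (hf : ContinuousAt f 0) (hg : ContinuousAt g 0) (h : f 0 < g 0) :
    ∀ᶠ δ in nhdsWithin (0:ℝ) (Set.Ioi 0), f δ < g δ :=
  (hf.tendsto.eventually_lt hg.tendsto h).filter_mono nhdsWithin_le_nhds

lemma Sd_Q (d : ℕ) : Sd d Q1 = Qset d := rfl

lemma Sd_U (d : ℕ) : Sd d Set.univ = Set.univ := by simp [Sd]

lemma abs_lt_aux (a c : ℝ) (ha : 0 < a) (hc : |c| < 1) : |a * c| < 2 * (a / 2) := by
  rw [abs_mul, abs_of_pos ha]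
  nlinarith

lemma abs_cos_lt (t : ℝ) (h : 0 < sin t) : |cos t| < 1 := by
  rw [← sq_lt_one_iff_abs_lt_one]
  nlinarith [sin_sq_add_cos_sq t]

lemma upperA (θ : ℝ) (hs : 0 < sin θ) (hc : 0 < cos θ)
    (μ : (d : ℕ) → Measure (Matrix.orthogonalGroup (Fin d) ℝ))
    (hHaar : ∀ d, (μ d).IsHaarMeasure) (hProb : ∀ d, IsProbabilityMeasure (μ d))
    (s : ℝ) (s0 : 0 < s) (s1 : s < π) (hD : 0 < s - sin s * cos s)
    (t : ℝ) (t0 : 0 < t) (t1 : t < π) (ht : cos θ < cos t) (R : ℝ)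
    (hR : mm s * (1 + cos s * cos t) - 1 + log (ZQ s) - log (2 * π * sin t) < R) :
    ∀ᶠ d in atTop, collProb d θ (μ d) ≤ 2 * exp (d * R) := by
  have hss : 0 < sin s := sin_pos_of_pos_of_lt_pi s0 s1
  have hst : 0 < sin t := sin_pos_of_pos_of_lt_pi t0 t1
  have hm : 0 < mm s := by unfold mm; positivity
  have hZ : 0 < ZQ s := by unfold ZQ; positivity
  have hU : 0 < 2 * π * sin t := by positivity
  have hct : cos t < 1 := (abs_lt.1 (abs_cos_lt t hst)).2
  set α := mm s / 2 with hα
  set γ := mm s * cos s with hγ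
  set α' := 1 / sin t ^ 2 / 2 with hα'
  set γ' := 1 / sin t ^ 2 * (-cos t) with hγ'
  have hab : |γ| < 2 * α := abs_lt_aux _ _ hm (abs_cos_lt s hss)
  have hab' : |γ'| < 2 * α' := abs_lt_aux _ _ (by positivity) (by rw [abs_neg]; exact abs_cos_lt t hst)
  have e2 : 2 * α' + γ' * cos t = 1 := by
    rw [hα', hγ']; field_simp; nlinarith [sin_sq_add_cos_sq t]
  obtain ⟨δ, ⟨⟨⟨⟨d1, d2⟩, d3⟩, d4⟩, hδ⟩⟩ : ∃ δ : ℝ, ((((δ < cos t) ∧ (cos t + 2 * δ < 1)) ∧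
      (cos θ * (1 + δ) < cos t - δ)) ∧ ((2 * |α| + |γ|) * δ + (2 * |α'| + |γ'|) * δ
        < R - (mm s * (1 + cos s * cos t) - 1 + log (ZQ s) - log (2 * π * sin t)))) ∧ 0 < δ := by
    refine Eventually.exists (f := nhdsWithin (0:ℝ) (Set.Ioi 0)) ?_
    refine Eventually.and (Eventually.and (Eventually.and (Eventually.and ?_ ?_) ?_) ?_) self_mem_nhdsWithin
    · exact ev_small (by fun_prop) (by fun_prop) (by linarith)
    · exact ev_small (by fun_prop) (by fun_prop) (by linarith)
    · exact ev_small (by fun_prop) (by fun_prop) (by linarith)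
    · exact ev_small (by fun_prop) (by fun_prop) (by linarith)
  obtain ⟨u0, u1, u2, u3⟩ := mom_U t t0 t1
  obtain ⟨q0, q1, q2, q3⟩ := mom_Q s s0 s1 hD
  have hlow := vol_lower α' γ' (cos t) δ hab' Set.univ MeasurableSet.univ hδ (by rw [u0]; exact hU)
    (by rw [u1, u0]) (by rw [u2, u0]) (by rw [u3, u0])
  filter_upwards [hlow, eventually_ge_atTop 2] with d hd h2
  obtain ⟨n, rfl⟩ : ∃ n, d = n + 2 := ⟨d - 2, by omega⟩
  have := hHaar (n + 2)
  have := hProb (n + 2)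
  have hp := upper_p n (μ (n+2)) θ hs hc (cos t) δ hδ d1 d2 d3.le
  have hup := vol_upper (n+2) α γ (cos t) δ hab Q1 Q1_meas
  rw [u0, Sd_U, Set.inter_univ, e2] at hd
  rw [q0, Sd_Q] at hup
  have h3 := (mul_le_mul_right hd (μ (n+2) (collisionEvent (n+2) θ))).trans (hp.trans hup)
  have hfin : μ (n+2) (collisionEvent (n+2) θ) ≠ ⊤ := measure_ne_top _ _
  have hpe : μ (n+2) (collisionEvent (n+2) θ) = ENNReal.ofReal (collProb (n+2) θ (μ (n+2))) :=
    (ENNReal.ofReal_toReal hfin).symm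
  have hp0 : 0 ≤ collProb (n+2) θ (μ (n+2)) := ENNReal.toReal_nonneg
  rw [hpe, ← ENNReal.ofReal_mul hp0, ENNReal.ofReal_le_ofReal_iff (by positivity)] at h3
  set p := collProb (n+2) θ (μ (n+2)) with hpdef
  set D : ℝ := ((n + 2 : ℕ) : ℝ) with hDdef
  have hDpos : 0 < D := by rw [hDdef]; positivity
  have pw1 : (2 * π * sin t) ^ (n+2) = exp (D * log (2 * π * sin t)) := by
    rw [mul_comm D, ← rpow_def_of_pos hU, rpow_natCast]
  have pw2 : ZQ s ^ (n+2) = exp (D * log (ZQ s)) := by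
    rw [mul_comm D, ← rpow_def_of_pos hZ, rpow_natCast]
  rw [pw1, pw2, ← exp_add, ← exp_add] at h3
  have h4 : exp (D * (2 * α + γ * cos t + (2 * |α| + |γ|) * δ) + D * log (ZQ s)) ≤
      exp (D * R) * exp (D * (1 - (2 * |α'| + |γ'|) * δ) + D * log (2 * π * sin t)) := by
    rw [← exp_add, exp_le_exp]
    have : 2 * α + γ * cos t = mm s * (1 + cos s * cos t) := by rw [hα, hγ]; ring
    rw [this]
    have := mul_lt_mul_of_pos_left d4 hDpos
    linarith
  set X := exp (D * (1 - (2 * |α'| + |γ'|) * δ) + D * log (2 * π * sin t)) with hX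
  have hXp : 0 < X := exp_pos _
  have h5 := h3.trans h4
  have : p * X ≤ (2 * exp (D * R)) * X := by linarith
  exact le_of_mul_le_mul_right this hXp

lemma lowerA (θ : ℝ) (hs : 0 < sin θ) (hc : 0 < cos θ)
    (μ : (d : ℕ) → Measure (Matrix.orthogonalGroup (Fin d) ℝ))
    (hHaar : ∀ d, (μ d).IsHaarMeasure) (hProb : ∀ d, IsProbabilityMeasure (μ d))
    (s : ℝ) (s0 : 0 < s) (s1 : s < π) (hD : 0 < s - sin s * cos s)
    (t : ℝ) (t0 : 0 < t) (t1 : t < π) (hst' : rh s = cos t) (htp : 0 < cos t) (ht : cos t < cos θ) (R : ℝ)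
    (hR : R < log (ZQ s) - log (2 * π * sin t)) :
    ∀ᶠ d : ℕ in atTop, 2⁻¹ * exp (d * R) ≤ collProb d θ (μ d) := by
  have hss : 0 < sin s := sin_pos_of_pos_of_lt_pi s0 s1
  have hst : 0 < sin t := sin_pos_of_pos_of_lt_pi t0 t1
  have hm : 0 < mm s := by unfold mm; positivity
  have hZ : 0 < ZQ s := by unfold ZQ; positivity
  have hU : 0 < 2 * π * sin t := by positivity
  have hct : cos t < 1 := (abs_lt.1 (abs_cos_lt t hst)).2
  have hmr : mm s * (1 + cos s * rh s) = 1 := by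
    have := hD.ne'
    unfold mm rh
    field_simp
    nlinarith [sin_sq_add_cos_sq s]
  set α := mm s / 2 with hα
  set γ := mm s * cos s with hγ
  set α' := 1 / sin t ^ 2 / 2 with hα'
  set γ' := 1 / sin t ^ 2 * (-cos t) with hγ'
  have hab : |γ| < 2 * α := abs_lt_aux _ _ hm (abs_cos_lt s hss)
  have hab' : |γ'| < 2 * α' := abs_lt_aux _ _ (by positivity) (by rw [abs_neg]; exact abs_cos_lt t hst)
  have e2 : 2 * α' + γ' * cos t = 1 := by
    rw [hα', hγ']; field_simp; nlinarith [sin_sq_add_cos_sq t]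
  have e1 : 2 * α + γ * cos t = 1 := by
    rw [← hst', hα, hγ, ← hmr]; ring
  obtain ⟨δ, ⟨⟨⟨⟨d1, d2⟩, d3⟩, d4⟩, hδ⟩⟩ : ∃ δ : ℝ, ((((δ < cos t) ∧ (cos t + 2 * δ < 1)) ∧
      (cos t + δ < cos θ * (1 - δ))) ∧ ((2 * |α| + |γ|) * δ + (2 * |α'| + |γ'|) * δ
        < (log (ZQ s) - log (2 * π * sin t)) - R)) ∧ 0 < δ := by
    refine Eventually.exists (f := nhdsWithin (0:ℝ) (Set.Ioi 0)) ?_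
    refine Eventually.and (Eventually.and (Eventually.and (Eventually.and ?_ ?_) ?_) ?_) self_mem_nhdsWithin
    · exact ev_small (by fun_prop) (by fun_prop) (by linarith)
    · exact ev_small (by fun_prop) (by fun_prop) (by linarith)
    · exact ev_small (by fun_prop) (by fun_prop) (by linarith)
    · exact ev_small (by fun_prop) (by fun_prop) (by linarith)
  obtain ⟨u0, u1, u2, u3⟩ := mom_U t t0 t1
  obtain ⟨q0, q1, q2, q3⟩ := mom_Q s s0 s1 hD
  have hlow := vol_lower α γ (cos t) δ hab Q1 Q1_meas hδ (by rw [q0]; exact hZ)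
    (by rw [q1, q0]) (by rw [q2, q0]) (by rw [q3, q0, hst'])
  filter_upwards [hlow, eventually_ge_atTop 2] with d hd h2
  obtain ⟨n, rfl⟩ : ∃ n, d = n + 2 := ⟨d - 2, by omega⟩
  have := hHaar (n + 2)
  have := hProb (n + 2)
  have hp := lower_p n (μ (n+2)) θ hs hc (cos t) δ hδ d1 d2 d3.le
  have hup := vol_upper (n+2) α' γ' (cos t) δ hab' Set.univ MeasurableSet.univ
  rw [q0, Sd_Q, e1] at hd
  rw [u0, Sd_U, Set.inter_univ, e2] at hup
  have h3 := hd.trans (hp.trans (mul_le_mul_right hup (μ (n+2) (collisionEvent (n+2) θ))))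
  have hfin : μ (n+2) (collisionEvent (n+2) θ) ≠ ⊤ := measure_ne_top _ _
  have hpe : μ (n+2) (collisionEvent (n+2) θ) = ENNReal.ofReal (collProb (n+2) θ (μ (n+2))) :=
    (ENNReal.ofReal_toReal hfin).symm
  have hp0 : 0 ≤ collProb (n+2) θ (μ (n+2)) := ENNReal.toReal_nonneg
  rw [hpe, ← ENNReal.ofReal_mul hp0, ENNReal.ofReal_le_ofReal_iff (by positivity)] at h3
  set p := collProb (n+2) θ (μ (n+2)) with hpdef
  set D : ℝ := ((n + 2 : ℕ) : ℝ) with hDdef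
  have hDpos : 0 < D := by rw [hDdef]; positivity
  have pw1 : (2 * π * sin t) ^ (n+2) = exp (D * log (2 * π * sin t)) := by
    rw [mul_comm D, ← rpow_def_of_pos hU, rpow_natCast]
  have pw2 : ZQ s ^ (n+2) = exp (D * log (ZQ s)) := by
    rw [mul_comm D, ← rpow_def_of_pos hZ, rpow_natCast]
  rw [pw1, pw2, ← exp_add, ← exp_add] at h3
  set X := exp (D * (1 + (2 * |α'| + |γ'|) * δ) + D * log (2 * π * sin t)) with hX
  have h4 : exp (D * R) * X ≤ exp (D * (1 - (2 * |α| + |γ|) * δ) + D * log (ZQ s)) := by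
    rw [hX, ← exp_add, exp_le_exp]
    have := mul_lt_mul_of_pos_left d4 hDpos
    linarith
  have hXp : 0 < X := exp_pos _
  have : (2⁻¹ * exp (D * R)) * X ≤ p * X := by linarith
  exact le_of_mul_le_mul_right this hXp

lemma fin_lim (p : ℕ → ℝ) (R : ℝ) (hu : ∀ ε > 0, ∀ᶠ d : ℕ in atTop, p d ≤ 2 * exp (d * (R + ε)))
    (hl : ∀ ε > 0, ∀ᶠ d : ℕ in atTop, 2⁻¹ * exp (d * (R - ε)) ≤ p d) :
    Tendsto (fun d : ℕ => (1 / (d:ℝ)) * log (p d)) atTop (nhds R) := by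
  rw [Metric.tendsto_atTop']
  intro ε hε
  have hlim : ∀ᶠ d : ℕ in atTop, log 2 / (d:ℝ) < ε / 2 :=
    (tendsto_const_div_atTop_nhds_zero_nat (log 2)).eventually_lt_const (by linarith)
  obtain ⟨N, hN⟩ := eventually_atTop.1 (((hu (ε/2) (by linarith)).and (hl (ε/2) (by linarith))).and
    (hlim.and (eventually_gt_atTop 0)))
  refine ⟨N, fun d hd => ?_⟩
  obtain ⟨⟨h1, h2⟩, h3, h4⟩ := hN d hd.le
  have hd0 : (0:ℝ) < d := by exact_mod_cast h4
  have hp : 0 < p d := lt_of_lt_of_le (by positivity) h2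
  have a1 : log (p d) ≤ log 2 + d * (R + ε/2) := by
    have := log_le_log hp h1
    rwa [log_mul (by norm_num) (exp_pos _).ne', log_exp] at this
  have a2 : -log 2 + d * (R - ε/2) ≤ log (p d) := by
    have := log_le_log (by positivity) h2
    rwa [log_mul (by norm_num) (exp_pos _).ne', log_exp, log_inv] at this
  rw [div_lt_iff₀ hd0] at h3
  rw [Real.dist_eq, abs_lt, one_div, inv_mul_eq_div]
  constructor
  · rw [lt_sub_iff_add_lt, lt_div_iff₀ hd0]; nlinarith
  · rw [sub_lt_iff_lt_add, div_lt_iff₀ hd0]; nlinarith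

lemma D_pos (s : ℝ) (h0 : 0 < s) (h1 : s < π / 2) : 0 < s - sin s * cos s := by
  have a := sin_lt h0
  have b := cos_le_one s
  have c : 0 < sin s := sin_pos_of_pos_of_lt_pi h0 (by linarith)
  nlinarith

lemma g1_pos (s : ℝ) (h0 : 0 < s) (h1 : s < π / 2) :
    0 < 3 * s - 3 * (sin s * cos s) - 2 * s * sin s ^ 2 := by
  have hd : ∀ x : ℝ, HasDerivAt (fun s => 3 * s - 3 * (sin s * cos s) - 2 * s * sin s ^ 2)
      (4 * sin x * (sin x - x * cos x)) x := by
    intro x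
    have h1 := (((hasDerivAt_id x).const_mul 3).sub (((hasDerivAt_sin x).mul (hasDerivAt_cos x)).const_mul 3)).sub
      (((hasDerivAt_id x).const_mul 2).mul ((hasDerivAt_sin x).pow 2))
    refine h1.congr_deriv ?_
    have := sin_sq_add_cos_sq x
    simp
    linear_combination (-3) * this
  have hm : StrictMonoOn (fun s => 3 * s - 3 * (sin s * cos s) - 2 * s * sin s ^ 2) (Set.Icc 0 (π / 2)) := by
    refine strictMonoOn_of_deriv_pos (convex_Icc _ _) (by fun_prop) fun x hx => ?_
    rw [interior_Icc] at hx
    rw [(hd x).deriv]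
    have hc : 0 < cos x := cos_pos_of_mem_Ioo ⟨by linarith [hx.1, pi_pos], hx.2⟩
    have hs : 0 < sin x := sin_pos_of_pos_of_lt_pi hx.1 (by linarith [hx.2, pi_pos])
    have := lt_tan hx.1 hx.2
    rw [tan_eq_sin_div_cos, lt_div_iff₀ hc] at this
    have : 0 < sin x - x * cos x := by linarith
    positivity
  have := hm ⟨le_rfl, by positivity⟩ ⟨h0.le, h1.le⟩ h0
  simpa using this

lemma g_pos (s : ℝ) (h0 : 0 < s) (h1 : s < π / 2) :
    0 < s ^ 2 + s * (sin s * cos s) - 2 * sin s ^ 2 := by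
  have hd : ∀ x : ℝ, HasDerivAt (fun s => s ^ 2 + s * (sin s * cos s) - 2 * sin s ^ 2)
      (3 * x - 3 * (sin x * cos x) - 2 * x * sin x ^ 2) x := by
    intro x
    have h1 := (((hasDerivAt_id x).pow 2).add ((hasDerivAt_id x).mul ((hasDerivAt_sin x).mul (hasDerivAt_cos x)))).sub
      (((hasDerivAt_sin x).pow 2).const_mul 2)
    refine h1.congr_deriv ?_
    have := sin_sq_add_cos_sq x
    simp
    linear_combination x * this
  have hm : StrictMonoOn (fun s => s ^ 2 + s * (sin s * cos s) - 2 * sin s ^ 2) (Set.Icc 0 (π / 2)) := by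
    refine strictMonoOn_of_deriv_pos (convex_Icc _ _) (by fun_prop) fun x hx => ?_
    rw [interior_Icc] at hx
    rw [(hd x).deriv]
    exact g1_pos x hx.1 hx.2
  have := hm ⟨le_rfl, by positivity⟩ ⟨h0.le, h1.le⟩ h0
  simpa using this

lemma rh_deriv (x : ℝ) (h0 : 0 < x) (h1 : x < π / 2) : ∃ y > 0, HasDerivAt rh y x := by
  have hD := D_pos x h0 h1
  have hs : 0 < sin x := sin_pos_of_pos_of_lt_pi h0 (by linarith)
  refine ⟨sin x * (x ^ 2 + x * (sin x * cos x) - 2 * sin x ^ 2) / (x - sin x * cos x) ^ 2,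
    div_pos (mul_pos hs (g_pos x h0 h1)) (by positivity), ?_⟩
  have h1 := ((hasDerivAt_sin x).sub ((hasDerivAt_id x).mul (hasDerivAt_cos x))).div
    ((hasDerivAt_id x).sub ((hasDerivAt_sin x).mul (hasDerivAt_cos x))) hD.ne'
  refine h1.congr_deriv ?_
  congr 1
  have h3 : cos x ^ 2 = 1 - sin x ^ 2 := by linarith [sin_sq_add_cos_sq x]
  simp
  linear_combination (sin x - x * cos x) * h3

lemma rh_mono : StrictMonoOn rh (Set.Ioo 0 (π / 2)) := by
  refine strictMonoOn_of_deriv_pos (convex_Ioo _ _) ?_ fun x hx => ?_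
  · intro x hx
    obtain ⟨y, _, h⟩ := rh_deriv x hx.1 hx.2
    exact h.continuousAt.continuousWithinAt
  · rw [interior_Ioo] at hx
    obtain ⟨y, hy, h⟩ := rh_deriv x hx.1 hx.2
    rwa [h.deriv]

theorem hypercube_lsh_collision_exponent_middle_angle
    (θ : ℝ) (hθ : θ ∈ Set.Ioo (Real.arccos (2 / π)) (π / 3))
    (β₁ : ℝ) (hβ₁ : 1 < β₁)
    (heq : Real.arccos (1 / β₁)
      = (β₁ + Real.cos θ) * Real.sqrt (β₁ ^ 2 - 1) / (β₁ * (β₁ * Real.cos θ + 1)))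
    (μ : (d : ℕ) → Measure (Matrix.orthogonalGroup (Fin d) ℝ))
    (hHaar : ∀ d, (μ d).IsHaarMeasure)
    (hProb : ∀ d, IsProbabilityMeasure (μ d)) :
    Tendsto (fun d : ℕ => (1 / (d : ℝ)) * Real.log (collProb d θ (μ d))) atTop
      (nhds (Real.log
        ((β₁ + Real.cos θ) ^ 2 / (π * β₁ * (β₁ * Real.cos θ + 1) * Real.sin θ)))) := by
  have hθ0 : 0 < θ := lt_of_le_of_lt (arccos_nonneg _) hθ.1
  have hθ1 : θ < π / 2 := by linarith [hθ.2, pi_pos]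
  have hθπ : θ < π := by linarith [pi_pos]
  have hsθ : 0 < sin θ := sin_pos_of_pos_of_lt_pi hθ0 hθπ
  have hcθ : 0 < cos θ := cos_pos_of_mem_Ioo ⟨by linarith, hθ1⟩
  have hβ0 : 0 < β₁ := by linarith
  set s := arccos (1 / β₁) with hsdef
  have hk0 : 0 < 1 / β₁ := by positivity
  have hk1 : 1 / β₁ < 1 := by rw [div_lt_one hβ0]; exact hβ₁
  have s0 : 0 < s := arccos_pos.2 hk1
  have s1 : s < π / 2 := arccos_lt_pi_div_two.2 hk0
  have sπ : s < π := by linarith [pi_pos]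
  have hck : cos s = 1 / β₁ := cos_arccos (by linarith) hk1.le
  have hss : 0 < sin s := sin_pos_of_pos_of_lt_pi s0 sπ
  have hβk : β₁ = 1 / cos s := by rw [hck]; simp
  have hc0 : 0 < cos s := by rw [hck]; exact hk0
  have hsq : sqrt (β₁ ^ 2 - 1) = sin s / cos s := by
    rw [sqrt_eq_iff_mul_self_eq_of_pos (by positivity), hβk]
    field_simp
    linarith [sin_sq_add_cos_sq s]
  have hD := D_pos s s0 s1
  have key : s * (cos θ + cos s) = (1 + cos θ * cos s) * sin s := by
    rw [hsq, hβk] at heq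
    have h1 : 0 < cos θ + cos s := by positivity
    field_simp at heq
    linarith
  have hrh : rh s = cos θ := by
    unfold rh
    rw [div_eq_iff hD.ne']
    linarith
  have hZ : 0 < ZQ s := by unfold ZQ; positivity
  have htar : (β₁ + cos θ) ^ 2 / (π * β₁ * (β₁ * cos θ + 1) * sin θ) = ZQ s / (2 * π * sin θ) := by
    have hp : 0 < cos θ + cos s := by positivity
    have k2 : (cos θ + cos s) * (s - sin s * cos s) = sin s ^ 3 := by
      have : cos θ * (s - sin s * cos s) = sin s - s * cos s := by
        rw [← hrh]; unfold rh; rw [div_mul_cancel₀ _ hD.ne']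
      linear_combination this - sin s * (sin_sq_add_cos_sq s)
    have k3 : (1 + cos θ * cos s) ^ 2 * (s - sin s * cos s) = s ^ 2 * sin s * (cos θ + cos s) := by
      have : sin s ^ 2 * ((1 + cos θ * cos s) ^ 2 * (s - sin s * cos s))
          = sin s ^ 2 * (s ^ 2 * sin s * (cos θ + cos s)) := by
        have e : sin s ^ 2 * ((1 + cos θ * cos s) ^ 2 * (s - sin s * cos s)) =
          ((1 + cos θ * cos s) * sin s) ^ 2 * (s - sin s * cos s) := by ring
        rw [e, ← key]
        linear_combination s ^ 2 * (cos θ + cos s) * k2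
      exact mul_left_cancel₀ (by positivity) this
    have l : (β₁ + cos θ) ^ 2 / (π * β₁ * (β₁ * cos θ + 1) * sin θ)
        = (1 + cos θ * cos s) ^ 2 / (π * (cos θ + cos s) * sin θ) := by
      rw [hβk]
      field_simp
      try ring
    have hD' := hD.ne'
    rw [l]
    unfold ZQ
    rw [div_div, div_eq_div_iff (by positivity) (by positivity)]
    linear_combination 2 * π * sin θ * k3
  rw [htar, log_div hZ.ne' (by positivity)]
  refine fin_lim _ _ (fun ε hε => ?_) (fun ε hε => ?_)
  · have hcont : ContinuousAt (fun t => mm s * (1 + cos s * cos t) - 1 + log (ZQ s)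
        - log (2 * π * sin t)) θ := by
      have : (2 * π * sin θ) ≠ 0 := by positivity
      fun_prop (disch := assumption)
    have hmr : mm s * (1 + cos s * rh s) = 1 := by
      have := hD.ne'
      unfold mm rh
      field_simp
      nlinarith [sin_sq_add_cos_sq s]
    rw [hrh] at hmr
    have e1 := hcont.tendsto.eventually_lt_const
      (u := log (ZQ s) - log (2 * π * sin θ) + ε) (by rw [hmr]; linarith)
    obtain ⟨t, ⟨h1, h2⟩, h3⟩ := (((e1.and (eventually_gt_nhds hθ0)).filter_mono
      (nhdsWithin_le_nhds (s := Set.Iio θ))).and self_mem_nhdsWithin).exists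
    have h3 : t < θ := h3
    exact upperA θ hsθ hcθ μ hHaar hProb s s0 sπ hD t h2 (by linarith)
      (cos_lt_cos_of_nonneg_of_le_pi h2.le hθπ.le h3) _ h1
  · have hrc : ContinuousAt rh s := by
      obtain ⟨y, _, h⟩ := rh_deriv s s0 s1
      exact h.continuousAt
    have hzc : ContinuousAt ZQ s := by
      have := hD.ne'
      unfold ZQ
      fun_prop (disch := assumption)
    have hac : ContinuousAt (fun x => 2 * π * sin (arccos (rh x))) s := by
      have : ContinuousAt (fun x => arccos (rh x)) s :=
        continuous_arccos.continuousAt.comp hrc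
      fun_prop
    have hathe : arccos (rh s) = θ := by rw [hrh]; exact arccos_cos hθ0.le hθπ.le
    have hcont : ContinuousAt (fun x => log (ZQ x) - log (2 * π * sin (arccos (rh x)))) s := by
      refine (hzc.log hZ.ne').sub (hac.log ?_)
      rw [hathe]; positivity
    have e1 := hcont.tendsto.eventually_const_lt
      (u := log (ZQ s) - log (2 * π * sin θ) - ε) (by rw [hathe]; linarith)
    have e2 := hrc.tendsto.eventually_const_lt (u := 0) (by rw [hrh]; exact hcθ)
    obtain ⟨x, ⟨⟨h1, h2⟩, h4⟩, h3⟩ := ((((e1.and e2).and (eventually_gt_nhds s0)).filter_mono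
      (nhdsWithin_le_nhds (s := Set.Iio s))).and self_mem_nhdsWithin).exists
    have h3 : x < s := h3
    have hlt : rh x < cos θ := by
      rw [← hrh]; exact rh_mono ⟨h4, by linarith⟩ ⟨s0, s1⟩ h3
    have hle := cos_le_one θ
    have hca : cos (arccos (rh x)) = rh x := cos_arccos (by linarith) (by linarith)
    exact lowerA θ hsθ hcθ μ hHaar hProb x h4 (by linarith) (D_pos x h4 (by linarith))
      (arccos (rh x)) (arccos_pos.2 (by linarith))
      (by have := arccos_lt_pi_div_two.2 h2; linarith [pi_pos]) hca.symm (by rw [hca]; exact h2)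
      (by rw [hca]; exact hlt) _ h1
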